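/- Let x ∈ ℒ_n be such that the orbit A·x has compact closure. Then for every ε ∈ (0,1), the set U_n^{x,ε} = {a ∈ A : δ ↦ dim_δ(ax) is constantly equal to n on some neighborhood of nε} is nonempty. -/

import Mathlib

open scoped BigOperators
open Matrix Topology Filter

noncomputable section

namespace SW

/-! ### Euclidean structure on `Fin n → ℝ` -/

/-- The standard Euclidean inner product on `Fin n → ℝ`. -/
def einner {n : ℕ} (v w : Fin n → ℝ) : ℝ := ∑ i, v i * w i

/-- The Euclidean norm on `Fin n → ℝ`. -/
def enorm {n : ℕ} (v : Fin n → ℝ) : ℝ := Real.sqrt (∑ i, v i ^ 2)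

lemma einner_add_left {n : ℕ} (u v w : Fin n → ℝ) :
    einner (u + v) w = einner u w + einner v w := by
  simp [einner, add_mul, Finset.sum_add_distrib]

lemma einner_neg_left {n : ℕ} (u w : Fin n → ℝ) : einner (-u) w = -einner u w := by
  simp [einner]

lemma einner_smul_left {n : ℕ} (c : ℝ) (u w : Fin n → ℝ) :
    einner (c • u) w = c * einner u w := by
  simp [einner, Finset.mul_sum, mul_assoc]

/-! ### Covolume, rank, lattices, stability -/

/-- `√(det Gram)` of a finite family of vectors: the covolume of the ℤ-span of the family
(in the span of the family) when the family is linearly independent. -/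
def gvol {n r : ℕ} (v : Fin r → (Fin n → ℝ)) : ℝ :=
  Real.sqrt (Matrix.det (Matrix.of fun i j => einner (v i) (v j)))

/-- `c` is the covolume of `Λ` in its real span, as computed from some ℤ-basis of `Λ` which is
linearly independent over `ℝ`. -/
def covolSpec {n : ℕ} (Λ : AddSubgroup (Fin n → ℝ)) (c : ℝ) : Prop :=
  ∃ (r : ℕ) (v : Fin r → (Fin n → ℝ)), LinearIndependent ℝ v ∧
    Λ = AddSubgroup.closure (Set.range v) ∧ c = gvol v

/-- The covolume of a discrete subgroup `Λ ⊆ ℝⁿ` inside its real span (with `covol ⊥ = 1`). -/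
def covol {n : ℕ} (Λ : AddSubgroup (Fin n → ℝ)) : ℝ := sInf {c | covolSpec Λ c}

/-- The rank of a discrete subgroup of `ℝⁿ`: the dimension of its real span. -/
def rk {n : ℕ} (Λ : AddSubgroup (Fin n → ℝ)) : ℕ :=
  Module.finrank ℝ (Submodule.span ℝ (Λ : Set (Fin n → ℝ)))

/-- A lattice in `ℝⁿ`: a discrete subgroup spanning `ℝⁿ` (equivalently, cocompact). -/
def IsLattice {n : ℕ} (L : AddSubgroup (Fin n → ℝ)) : Prop :=
  DiscreteTopology ↥L ∧ Submodule.span ℝ (L : Set (Fin n → ℝ)) = ⊤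

/-- A unimodular lattice: a lattice of covolume one. -/
def IsUnimodularLattice {n : ℕ} (L : AddSubgroup (Fin n → ℝ)) : Prop :=
  IsLattice L ∧ covol L = 1

/-- A stable lattice: a unimodular lattice all of whose subgroups have covolume at least one. -/
def IsStable {n : ℕ} (L : AddSubgroup (Fin n → ℝ)) : Prop :=
  IsUnimodularLattice L ∧ ∀ Λ : AddSubgroup (Fin n → ℝ), Λ ≤ L → 1 ≤ covol Λ

/-! ### Matrices: the diagonal group `A`, `SL_n(ℤ)`, lattices from matrices -/

/-- The group `A` of positive diagonal matrices of determinant one (as a set of matrices). -/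
def Apos (n : ℕ) : Set (Matrix (Fin n) (Fin n) ℝ) :=
  {a | ∃ d : Fin n → ℝ, (∀ i, 0 < d i) ∧ (∏ i, d i) = 1 ∧ a = Matrix.diagonal d}

/-- `SL_n(ℤ)` viewed as a set of real matrices. -/
def Gam (n : ℕ) : Set (Matrix (Fin n) (Fin n) ℝ) :=
  {γ | γ.det = 1 ∧ ∀ i j, ∃ m : ℤ, γ i j = (m : ℝ)}

/-- The lattice `g·ℤⁿ` associated to a matrix `g`. -/
def latticeOf {n : ℕ} (g : Matrix (Fin n) (Fin n) ℝ) : AddSubgroup (Fin n → ℝ) :=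
  AddSubgroup.closure (Set.range fun m : Fin n → ℤ => g.mulVec fun i => (m i : ℝ))

/-- The image `g·L` of a lattice under a matrix. -/
def mapLat {n : ℕ} (g : Matrix (Fin n) (Fin n) ℝ) (L : AddSubgroup (Fin n → ℝ)) :
    AddSubgroup (Fin n → ℝ) :=
  AddSubgroup.map (Matrix.mulVecLin g).toAddMonoidHom L

/-- The full preimage `A·g·Γ` in `SL_n(ℝ)` of the orbit `A·[g] ⊆ ℒ_n`; a point `[h] ∈ ℒ_n`
lies in the closure of `A·[g]` iff `h ∈ closure (AOrbit g)`. -/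
def AOrbit {n : ℕ} (g : Matrix (Fin n) (Fin n) ℝ) : Set (Matrix (Fin n) (Fin n) ℝ) :=
  {p | ∃ a ∈ Apos n, ∃ γ ∈ Gam n, p = a * g * γ}

/-- The orbit `A·[g] ⊆ ℒ_n` is bounded (has compact closure). -/
def HasBoundedAOrbit {n : ℕ} (g : Matrix (Fin n) (Fin n) ℝ) : Prop :=
  ∃ K : Set (Matrix (Fin n) (Fin n) ℝ), IsCompact K ∧
    ∀ a ∈ Apos n, ∃ γ ∈ Gam n, a * g * γ ∈ K

/-! ### `α`, `Min_δ`, `V_δ`, `dim_δ` -/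

/-- `α(x) = min { |Λ|^{1/r(Λ)} : Λ a nonzero subgroup of x }`. -/
def alpha {n : ℕ} (x : AddSubgroup (Fin n → ℝ)) : ℝ :=
  sInf {c | ∃ Λ : AddSubgroup (Fin n → ℝ), Λ ≤ x ∧ Λ ≠ ⊥ ∧ c = covol Λ ^ ((rk Λ : ℝ)⁻¹)}

/-- `α_k(x) = min { |Λ|^{1/k} : Λ a rank-`k` subgroup of x }`. -/
def alphak {n : ℕ} (k : ℕ) (x : AddSubgroup (Fin n → ℝ)) : ℝ :=
  sInf {c | ∃ Λ : AddSubgroup (Fin n → ℝ), Λ ≤ x ∧ rk Λ = k ∧ c = covol Λ ^ ((k : ℝ)⁻¹)}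

/-- `Min_δ(x)`: nonzero subgroups nearly attaining `α(x)`. -/
def MinSet {n : ℕ} (δ : ℝ) (x : AddSubgroup (Fin n → ℝ)) : Set (AddSubgroup (Fin n → ℝ)) :=
  {Λ | Λ ≤ x ∧ Λ ≠ ⊥ ∧ covol Λ ^ ((rk Λ : ℝ)⁻¹) < (1 + δ) * alpha x}

/-- `V_δ(x)`: the span of the subgroups in `Min_δ(x)`. -/
def Vdelta {n : ℕ} (δ : ℝ) (x : AddSubgroup (Fin n → ℝ)) : Submodule ℝ (Fin n → ℝ) :=
  Submodule.span ℝ (⋃ Λ ∈ MinSet δ x, (Λ : Set (Fin n → ℝ)))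

/-- `dim_δ(x) = dim V_δ(x)`. -/
def dimdelta {n : ℕ} (δ : ℝ) (x : AddSubgroup (Fin n → ℝ)) : ℕ :=
  Module.finrank ℝ (Vdelta δ x)

/-- `U_k^{x,ε} ⊆ A`: those `a` for which `δ ↦ dim_δ(ax)` equals `k` near `kε`. -/
def Uset {n : ℕ} (x : AddSubgroup (Fin n → ℝ)) (ε : ℝ) (k : ℕ) :
    Set (Matrix (Fin n) (Fin n) ℝ) :=
  {a | a ∈ Apos n ∧ ∃ s ∈ 𝓝 ((k : ℝ) * ε), ∀ δ ∈ s, dimdelta δ (mapLat a x) = k}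

/-- Logarithmic coordinates on the diagonal group. -/
def logCoord {n : ℕ} (a : Matrix (Fin n) (Fin n) ℝ) : Fin n → ℝ := fun i => Real.log (a i i)

/-! ### Covering radius -/

/-- The covering radius `covrad(L) = sup_u inf_{v ∈ L} ‖u - v‖`. -/
def covrad {n : ℕ} (L : AddSubgroup (Fin n → ℝ)) : ℝ :=
  ⨆ u : Fin n → ℝ, ⨅ v : L, enorm (u - (v : Fin n → ℝ))

/-- `[g]` is a local maximum of `covrad : ℒ_d → ℝ` (phrased via the open quotient
`SL_d(ℝ) → ℒ_d`). -/
def IsLocalMaxCovrad {d : ℕ} (g : Matrix (Fin d) (Fin d) ℝ) : Prop :=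
  ∃ W ∈ 𝓝 g, ∀ g' ∈ W, Matrix.det g' = 1 → covrad (latticeOf g') ≤ covrad (latticeOf g)

/-! ### Block upper triangular form -/

/-- Offset of the `i`-th diagonal block. -/
def off {k : ℕ} (ns : Fin k → ℕ) (i : Fin k) : ℕ :=
  ∑ j ∈ Finset.univ.filter (fun j => j < i), ns j

lemma off_add_lt {k : ℕ} (ns : Fin k → ℕ) (i : Fin k) (a : Fin (ns i)) :
    off ns i + (a : ℕ) < ∑ j, ns j := by
  unfold off
  have hins : i ∉ Finset.univ.filter (fun j => j < i) := by simp
  have h2 : ∑ j ∈ insert i (Finset.univ.filter (fun j => j < i)), ns j ≤ ∑ j, ns j :=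
    Finset.sum_le_sum_of_subset (Finset.subset_univ _)
  rw [Finset.sum_insert hins] at h2
  have := a.isLt
  omega

/-- The position, in `Fin n`, of the `a`-th coordinate of the `i`-th block. -/
def blockEmb {n k : ℕ} (ns : Fin k → ℕ) (hsum : (∑ j, ns j) = n) (i : Fin k)
    (a : Fin (ns i)) : Fin n :=
  ⟨off ns i + (a : ℕ), hsum ▸ off_add_lt ns i a⟩

/-- `g` is block upper triangular with diagonal blocks `G i` (block sizes `ns`). -/
def IsBlockUT {n k : ℕ} (ns : Fin k → ℕ) (hsum : (∑ j, ns j) = n)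
    (g : Matrix (Fin n) (Fin n) ℝ) (G : ∀ i, Matrix (Fin (ns i)) (Fin (ns i)) ℝ) : Prop :=
  (∀ (i : Fin k) (a b : Fin (ns i)),
      g (blockEmb ns hsum i a) (blockEmb ns hsum i b) = G i a b) ∧
  (∀ (i j : Fin k) (a : Fin (ns i)) (b : Fin (ns j)), j < i →
      g (blockEmb ns hsum i a) (blockEmb ns hsum j b) = 0)

/-! ### Mordell constant -/

/-- The symmetric box `[-a₁,a₁] × ⋯ × [-aₙ,aₙ]` is admissible for `L`: its interior contains
no nonzero point of `L`. -/
def IsAdmissibleBox {n : ℕ} (L : AddSubgroup (Fin n → ℝ)) (a : Fin n → ℝ) : Prop :=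
  (∀ i, 0 < a i) ∧ ∀ v ∈ L, v ≠ 0 → ∃ i, a i ≤ |v i|

/-- The Mordell constant `κ(L) = 2⁻ⁿ sup { Vol(B) : B admissible symmetric box for L }`. -/
def mordellConst {n : ℕ} (L : AddSubgroup (Fin n → ℝ)) : ℝ :=
  (1 / 2 ^ n) * sSup {V | ∃ a : Fin n → ℝ, IsAdmissibleBox L a ∧ V = ∏ i, 2 * a i}

/-! ### Hermite constant -/

/-- Length of a shortest nonzero vector of `L`. -/
def shortest {m : ℕ} (L : AddSubgroup (Fin m → ℝ)) : ℝ :=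
  sInf {t | ∃ w ∈ L, w ≠ 0 ∧ t = enorm w}

/-- The Hermite constant `γ_m`. -/
def hermiteConst (m : ℕ) : ℝ :=
  sSup {c | ∃ L : AddSubgroup (Fin m → ℝ), IsUnimodularLattice L ∧ c = shortest L ^ 2}

/-! ### Korkine–Zolotarev reduction -/

/-- `v 0, …, v (n-1)` is a Korkine–Zolotarev reduced basis of `x`: it is a ℤ-basis, and for
each `i` the orthogonal projection of `v i` onto `span(v 0, …, v (i-1))^⊥` is shortest among the
nonzero such projections of vectors of `x` (projection lengths are expressed through Gram
determinants: the projection of `w` has length `gvol (v 0, …, v (i-1), w) / gvol (v 0, …, v (i-1))`). -/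
def IsKZBasis {n : ℕ} (x : AddSubgroup (Fin n → ℝ)) (v : ℕ → (Fin n → ℝ)) : Prop :=
  LinearIndependent ℝ (fun j : Fin n => v (j : ℕ)) ∧
  x = AddSubgroup.closure (v '' Set.Iio n) ∧
  ∀ i < n, ∀ w ∈ x, w ∉ Submodule.span ℝ (v '' Set.Iio i) →
    gvol (Fin.snoc (fun j : Fin i => v (j : ℕ)) (v i)) ≤
      gvol (Fin.snoc (fun j : Fin i => v (j : ℕ)) w)

/-- `A 0, …, A (n-1)` are the diagonal Korkine–Zolotarev coefficients of `x`: the lengths of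
the successive orthogonal projections in a KZ reduced basis, i.e.
`A i = gvol (v 0, …, v i) / gvol (v 0, …, v (i-1))`. -/
def HasKZCoeffs {n : ℕ} (x : AddSubgroup (Fin n → ℝ)) (A : ℕ → ℝ) : Prop :=
  ∃ v : ℕ → (Fin n → ℝ), IsKZBasis x v ∧
    ∀ i < n, A i * gvol (fun j : Fin i => v (j : ℕ)) = gvol (fun j : Fin (i + 1) => v (j : ℕ))

/-! ### Orthogonal complements and projections of lattices -/

/-- The orthogonal complement of a subspace `V ⊆ ℝⁿ`. -/
def orthoC {n : ℕ} (V : Submodule ℝ (Fin n → ℝ)) : Submodule ℝ (Fin n → ℝ) where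
  carrier := {w | ∀ v ∈ V, einner w v = 0}
  zero_mem' := by intro v hv; simp [einner]
  add_mem' := by intro a b ha hb v hv; rw [einner_add_left, ha v hv, hb v hv, add_zero]
  smul_mem' := by intro c w hw v hv; rw [einner_smul_left, hw v hv, mul_zero]

/-- The image `π(x)` of `x` under the orthogonal projection `π : ℝⁿ → V^⊥`:
`p = π(u)` iff `p ⊥ V` and `u - p ∈ V`. -/
def projLat {n : ℕ} (V : Submodule ℝ (Fin n → ℝ)) (x : AddSubgroup (Fin n → ℝ)) :
    AddSubgroup (Fin n → ℝ) where
  carrier := {p | (∀ v ∈ V, einner p v = 0) ∧ ∃ u ∈ x, u - p ∈ V}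
  zero_mem' := ⟨by intro v hv; simp [einner], 0, x.zero_mem, by rw [sub_zero]; exact V.zero_mem⟩
  add_mem' := by
    rintro p q ⟨hp1, u1, hu1, hp2⟩ ⟨hq1, u2, hu2, hq2⟩
    refine ⟨fun v hv => by rw [einner_add_left, hp1 v hv, hq1 v hv, add_zero],
      u1 + u2, x.add_mem hu1 hu2, ?_⟩
    have h : u1 + u2 - (p + q) = u1 - p + (u2 - q) := by abel
    rw [h]; exact V.add_mem hp2 hq2
  neg_mem' := by
    rintro p ⟨hp1, u, hu, hp2⟩
    refine ⟨fun v hv => by rw [einner_neg_left, hp1 v hv, neg_zero],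
      -u, x.neg_mem hu, ?_⟩
    have h : -u - -p = -(u - p) := by abel
    rw [h]; exact V.neg_mem hp2

end SW

namespace SW

/-- A commuting family of real symmetric matrices is simultaneously diagonalised by an orthogonal
matrix. -/
lemma exists_orthogonal_diagonalizing {n : ℕ} {ι : Type*} (T : ι → Matrix (Fin n) (Fin n) ℝ)
    (hT : ∀ i, (T i)ᵀ = T i) (hc : ∀ i j, T i * T j = T j * T i) :
    ∃ U : Matrix (Fin n) (Fin n) ℝ, Uᵀ * U = 1 ∧ ∀ i, ∃ d, T i * U = U * diagonal d := by
  classical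
  let S : ι → EuclideanSpace ℝ (Fin n) →ₗ[ℝ] EuclideanSpace ℝ (Fin n) :=
    fun i => Matrix.toEuclideanLin (T i)
  have hS : ∀ i, (S i).IsSymmetric := fun i =>
    Matrix.isSymmetric_toEuclideanLin_iff.mpr (by
      rw [Matrix.IsHermitian, Matrix.conjTranspose_eq_transpose_of_trivial, hT])
  have hC : Pairwise (Function.onFun Commute S) := by
    intro i j _
    change S i * S j = S j * S i
    ext v : 1
    simp only [S, Module.End.mul_apply, Matrix.toLpLin_apply, Matrix.mulVec_mulVec, hc i j]
  have hI := LinearMap.IsSymmetric.directSum_isInternal_of_pairwise_commute hS hC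
  have hO := LinearMap.IsSymmetric.orthogonalFamily_iInf_eigenspaces hS
  have hfin := WellFoundedGT.finite_ne_bot_of_iSupIndep hI.submodule_iSupIndep
  have : Fintype {χ : ι → ℝ // (⨅ j, Module.End.eigenspace (S j) (χ j)) ≠ ⊥} := hfin.fintype
  have hI' := DirectSum.isInternal_ne_bot_iff.mpr hI
  have hO' := hO.comp (Subtype.val_injective
    (p := fun χ : ι → ℝ => (⨅ j, Module.End.eigenspace (S j) (χ j)) ≠ ⊥))
  have hn : Module.finrank ℝ (EuclideanSpace ℝ (Fin n)) = n := by simp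
  obtain ⟨u, χ, hu⟩ : ∃ (u : OrthonormalBasis (Fin n) ℝ (EuclideanSpace ℝ (Fin n)))
      (χ : Fin n → ι → ℝ), ∀ a, u a ∈ ⨅ j, Module.End.eigenspace (S j) (χ a j) :=
    ⟨hI'.subordinateOrthonormalBasis hn hO',
      fun a => (hI'.subordinateOrthonormalBasisIndex hn a hO').1,
      fun a => hI'.subordinateOrthonormalBasis_subordinate hn a hO'⟩
  refine ⟨Matrix.of fun i a => u a i, ?_, fun i => ⟨fun a => χ a i, ?_⟩⟩
  · ext a b
    have := orthonormal_iff_ite.mp u.orthonormal a b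
    rw [Matrix.mul_apply, Matrix.one_apply, ← this, PiLp.inner_apply]
    simp [mul_comm]
  · ext k a
    have h2 := Module.End.mem_eigenspace_iff.mp ((Submodule.mem_iInf _).mp (hu a) i)
    have h3 := congrArg (fun v : EuclideanSpace ℝ (Fin n) => v k) h2
    rw [Matrix.mul_diagonal, Matrix.mul_apply]
    simpa [S, Matrix.toLpLin_apply, Matrix.mulVec, dotProduct, mul_comm] using h3

/-- Prescribing traces against a commuting family: either some nonzero-effect diagonal matrix fails
to commute, or the traces of any matrix are realised by a diagonal one. -/
lemma exists_diagonal_trace_eq {n : ℕ} {ι : Type*} (P : ι → Matrix (Fin n) (Fin n) ℝ)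
    (hP : ∀ i, (P i)ᵀ = P i) (hc : ∀ i j, P i * P j = P j * P i)
    (hL : ∀ b : Fin n → ℝ, ∑ k, b k = 0 → (∀ i, (diagonal b * P i).trace = 0) →
      ∀ i, diagonal b * P i = P i * diagonal b)
    (Y : Matrix (Fin n) (Fin n) ℝ) :
    ∃ b : Fin n → ℝ, ∑ k, b k = Y.trace ∧ ∀ i, (diagonal b * P i).trace = (Y * P i).trace := by
  let L := {b : Fin n → ℝ // ∑ k, b k = 0 ∧ ∀ i, (diagonal b * P i).trace = 0}
  obtain ⟨U, hU, hd⟩ := exists_orthogonal_diagonalizing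
    (Sum.elim P (fun b : L => diagonal b.1))
    (by rintro (i | b) <;> simp [hP]) (by
      rintro (i | b) (j | b')
      · exact hc i j
      · exact (hL _ b'.2.1 b'.2.2 i).symm
      · exact hL _ b.2.1 b.2.2 j
      · simp [mul_comm])
  have hU' : U * Uᵀ = 1 := mul_eq_one_comm.mp hU
  -- the traces only depend on the diagonal entries in the joint eigenbasis
  have key : ∀ (X : Matrix (Fin n) (Fin n) ℝ) (i : ι) (d : Fin n → ℝ), P i * U = U * diagonal d →
      (X * P i).trace = ∑ a, (Uᵀ * X * U) a a * d a := by
    intro X i d h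
    have : X * P i = X * U * diagonal d * Uᵀ := by
      rw [Matrix.mul_assoc X, ← h, Matrix.mul_assoc, Matrix.mul_assoc (P i), hU', Matrix.mul_one]
    rw [this, Matrix.trace_mul_comm, ← Matrix.mul_assoc, ← Matrix.mul_assoc]
    simp [Matrix.trace, Matrix.mul_diagonal]
  have key0 : ∀ X : Matrix (Fin n) (Fin n) ℝ, X.trace = ∑ a, (Uᵀ * X * U) a a := by
    intro X
    have : (Uᵀ * X * U).trace = X.trace := by
      rw [Matrix.trace_mul_comm, ← Matrix.mul_assoc, hU', Matrix.one_mul]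
    rw [← this]; rfl
  let B : (Fin n → ℝ) →ₗ[ℝ] (Fin n → ℝ) :=
    { toFun := fun b a => (Uᵀ * diagonal b * U) a a
      map_add' := fun b c => by
        have : diagonal (b + c) = diagonal b + diagonal c := (Matrix.diagonal_add b c).symm
        ext a
        change (Uᵀ * diagonal (b + c) * U) a a = _ + _
        rw [this, Matrix.mul_add, Matrix.add_mul, Matrix.add_apply]
      map_smul' := fun r b => by
        ext a
        rw [Matrix.diagonal_smul]; simp }
  have hBinj : Function.Injective B := by
    rw [injective_iff_map_eq_zero]
    intro b hb
    have hb' : ∀ a, (Uᵀ * diagonal b * U) a a = 0 := fun a => congrFun hb a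
    have h1 : ∑ k, b k = 0 := by
      rw [← Matrix.trace_diagonal, key0]; simp [hb']
    have h2 : ∀ i, (diagonal b * P i).trace = 0 := by
      intro i
      obtain ⟨d, h⟩ := hd (Sum.inl i)
      rw [key _ i d h]; simp [hb']
    obtain ⟨d, h⟩ := hd (Sum.inr ⟨b, h1, h2⟩)
    simp only [Sum.elim_inr] at h
    have h3 : Uᵀ * diagonal b * U = diagonal d := by
      rw [Matrix.mul_assoc, h, ← Matrix.mul_assoc, hU, Matrix.one_mul]
    have h4 : d = 0 := by
      ext a; have := hb' a; rw [h3] at this; simpa using this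
    have h5 : diagonal b = 0 := by
      calc diagonal b = diagonal b * U * Uᵀ := by rw [Matrix.mul_assoc, hU', Matrix.mul_one]
        _ = 0 := by rw [h, h4]; simp
    ext k
    have := congrFun (congrFun h5 k) k
    simpa using this
  obtain ⟨b, hb⟩ := (LinearMap.injective_iff_surjective.mp hBinj) (fun a => (Uᵀ * Y * U) a a)
  have hb' : ∀ a, (Uᵀ * diagonal b * U) a a = (Uᵀ * Y * U) a a := fun a => congrFun hb a
  refine ⟨b, ?_, fun i => ?_⟩
  · rw [← Matrix.trace_diagonal, key0, key0 Y]; simp [hb']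
  · obtain ⟨d, h⟩ := hd (Sum.inl i)
    rw [key _ i d h, key Y i d h]; simp [hb']

/-- The Gram determinant of the columns of `N`. -/
def gram {n : ℕ} {ι : Type*} [Fintype ι] [DecidableEq ι] (N : Matrix (Fin n) ι ℝ) : ℝ :=
  (Nᵀ * N).det

/-- The orthogonal projection onto the column space of `N`. -/
def colProj {n : ℕ} {ι : Type*} [Fintype ι] [DecidableEq ι] (N : Matrix (Fin n) ι ℝ) :
    Matrix (Fin n) (Fin n) ℝ :=
  N * (Nᵀ * N)⁻¹ * Nᵀ

section ColProj

variable {n : ℕ} {ι : Type*} [Fintype ι] [DecidableEq ι] {N : Matrix (Fin n) ι ℝ}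

lemma colProj_transpose (N : Matrix (Fin n) ι ℝ) : (colProj N)ᵀ = colProj N := by
  simp [colProj, Matrix.transpose_mul, Matrix.transpose_nonsing_inv, Matrix.mul_assoc]

lemma colProj_mul_self (h : gram N ≠ 0) : colProj N * N = N := by
  rw [colProj, Matrix.mul_assoc, Matrix.mul_assoc,
    Matrix.nonsing_inv_mul _ (isUnit_iff_ne_zero.mpr h), Matrix.mul_one]

lemma colProj_mul_colProj (h : gram N ≠ 0) : colProj N * colProj N = colProj N := by
  nth_rewrite 2 [colProj]
  rw [← Matrix.mul_assoc, ← Matrix.mul_assoc, colProj_mul_self h, colProj]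

lemma trace_colProj (h : gram N ≠ 0) : (colProj N).trace = Fintype.card ι := by
  rw [colProj, Matrix.trace_mul_comm, ← Matrix.mul_assoc,
    Matrix.mul_nonsing_inv _ (isUnit_iff_ne_zero.mpr h), Matrix.trace_one]

lemma mul_colProj_congr {P Q : Matrix (Fin n) (Fin n) ℝ} (h : P * N = Q * N) :
    P * colProj N = Q * colProj N := by
  rw [colProj, ← Matrix.mul_assoc, ← Matrix.mul_assoc, h, Matrix.mul_assoc, Matrix.mul_assoc,
    ← Matrix.mul_assoc N]

lemma mul_colProj_of_mul_eq {P : Matrix (Fin n) (Fin n) ℝ} (h : P * N = N) :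
    P * colProj N = colProj N := by
  rw [mul_colProj_congr (Q := 1) (by rw [h, Matrix.one_mul]), Matrix.one_mul]

end ColProj

section Expansion

variable {n r : ℕ}

lemma det_mul_eq_sum (A : Matrix (Fin r) (Fin n) ℝ) (B : Matrix (Fin n) (Fin r) ℝ) :
    (A * B).det = ∑ f : Fin r → Fin n, (∏ i, A i (f i)) * (B.submatrix f id).det := by
  have h : (A * B) = fun i => ∑ k, A i k • B k := by
    ext i j; simp [Matrix.mul_apply, Finset.sum_apply]
  have h2 := (Matrix.detRowAlternating (R := ℝ) (n := Fin r)).toMultilinearMap.map_sum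
    (fun i k => A i k • B k)
  have h3 : (A * B).det = Matrix.detRowAlternating (R := ℝ) (n := Fin r)
    (fun i => ∑ k, A i k • B k) := by rw [← h]; rfl
  rw [h3]
  refine h2.trans (Finset.sum_congr rfl fun f _ => ?_)
  rw [MultilinearMap.map_smul_univ]
  rfl

/-- A weighted Cauchy–Binet formula. -/
lemma det_transpose_mul_diagonal_mul (N : Matrix (Fin n) (Fin r) ℝ) (d : Fin n → ℝ) :
    (Nᵀ * (diagonal d * N)).det =
      ∑ f : Fin r → Fin n, (N.submatrix f id).det ^ 2 / (r.factorial : ℝ) * ∏ i, d (f i) := by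
  have h1 : ∀ f : Fin r → Fin n, ((diagonal d * N).submatrix f id).det =
      (∏ i, d (f i)) * (N.submatrix f id).det := by
    intro f
    rw [← Matrix.det_mul_column]
    congr 1
    ext i j; simp [Matrix.diagonal_mul]
  set T : (Fin r → Fin n) → ℝ := fun f =>
    (∏ i, N (f i) i) * ((∏ i, d (f i)) * (N.submatrix f id).det) with hT
  have h2 : (Nᵀ * (diagonal d * N)).det = ∑ f, T f := by
    rw [det_mul_eq_sum]
    simp only [h1, Matrix.transpose_apply, hT]
  have h3 : ∀ σ : Equiv.Perm (Fin r), ∑ f, T (f ∘ σ) = ∑ f, T f := fun σ =>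
    Equiv.sum_comp (σ.arrowCongr (Equiv.refl (Fin n))).symm T
  have h4 : ∀ f : Fin r → Fin n, ∑ σ : Equiv.Perm (Fin r), T (f ∘ σ) =
      (N.submatrix f id).det ^ 2 * ∏ i, d (f i) := by
    intro f
    have : ∀ σ : Equiv.Perm (Fin r), T (f ∘ σ) =
        ((Equiv.Perm.sign σ : ℤ) * ∏ i, N (f (σ i)) i) *
          ((∏ i, d (f i)) * (N.submatrix f id).det) := by
      intro σ
      have e1 : (N.submatrix (f ∘ σ) id).det =
          (Equiv.Perm.sign σ : ℤ) * (N.submatrix f id).det := by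
        have := Matrix.det_permute σ (N.submatrix f id)
        simpa [Matrix.submatrix_submatrix] using this
      have e2 : ∏ i, d ((f ∘ σ) i) = ∏ i, d (f i) :=
        Equiv.prod_comp σ (fun i => d (f i))
      simp only [hT]
      rw [e1, e2]
      simp only [Function.comp]
      ring
    simp only [this]
    rw [← Finset.sum_mul]
    have e3 : ∑ σ : Equiv.Perm (Fin r), ((Equiv.Perm.sign σ : ℤ) : ℝ) * ∏ i, N (f (σ i)) i =
        (N.submatrix f id).det := by
      rw [Matrix.det_apply']; rfl
    rw [e3]; ring
  have h5 : (r.factorial : ℝ) * ∑ f, T f =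
      ∑ f : Fin r → Fin n, (N.submatrix f id).det ^ 2 * ∏ i, d (f i) := by
    calc (r.factorial : ℝ) * ∑ f, T f = ∑ _σ : Equiv.Perm (Fin r), ∑ f, T f := by
          simp [Fintype.card_perm]
      _ = ∑ σ : Equiv.Perm (Fin r), ∑ f, T (f ∘ σ) := by simp only [h3]
      _ = ∑ f, ∑ σ : Equiv.Perm (Fin r), T (f ∘ σ) := Finset.sum_comm
      _ = _ := by simp only [h4]
  have hr : (r.factorial : ℝ) ≠ 0 := by exact_mod_cast r.factorial_ne_zero
  rw [h2]
  apply mul_left_cancel₀ hr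
  rw [h5, Finset.mul_sum]
  refine Finset.sum_congr rfl fun f _ => ?_
  field_simp

/-- The normalised squared Plücker coordinates of the columns of `N`. -/
def pluckerWeight (N : Matrix (Fin n) (Fin r) ℝ) (f : Fin r → Fin n) : ℝ :=
  (N.submatrix f id).det ^ 2 / (r.factorial : ℝ)

lemma pluckerWeight_nonneg (N : Matrix (Fin n) (Fin r) ℝ) (f : Fin r → Fin n) :
    0 ≤ pluckerWeight N f := by
  unfold pluckerWeight; positivity

lemma gram_diagonal_mul (N : Matrix (Fin n) (Fin r) ℝ) (d : Fin n → ℝ) :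
    gram (diagonal d * N) = ∑ f, pluckerWeight N f * ∏ i, d (f i) ^ 2 := by
  have : (diagonal d * N)ᵀ * (diagonal d * N) = Nᵀ * (diagonal (fun i => d i ^ 2) * N) := by
    rw [Matrix.transpose_mul, Matrix.diagonal_transpose, Matrix.mul_assoc, ← Matrix.mul_assoc _ _ N,
      Matrix.diagonal_mul_diagonal]
    simp only [pow_two]
  rw [gram, this, det_transpose_mul_diagonal_mul]
  rfl

lemma gram_eq_sum (N : Matrix (Fin n) (Fin r) ℝ) : gram N = ∑ f, pluckerWeight N f := by
  have := gram_diagonal_mul N 1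
  simpa using this

lemma sum_pluckerWeight_mul_sum (N : Matrix (Fin n) (Fin r) ℝ) (h : gram N ≠ 0) (b : Fin n → ℝ) :
    ∑ f, pluckerWeight N f * ∑ i, b (f i) = gram N * (diagonal b * colProj N).trace := by
  set G := Nᵀ * N with hG
  have hGu : IsUnit G.det := isUnit_iff_ne_zero.mpr h
  set M := G⁻¹ * (Nᵀ * (diagonal b * N)) with hM
  have h1 : ∀ s : ℝ, ∑ f, pluckerWeight N f * ∏ i, (1 + s * b (f i)) =
      gram N * (1 + s • M).det := by
    intro s
    have e1 : Nᵀ * (diagonal (fun k => 1 + s * b k) * N) = G * (1 + s • M) := by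
      have : (diagonal fun k => 1 + s * b k) = 1 + s • diagonal b := by
        rw [← Matrix.diagonal_one, ← Matrix.diagonal_smul, Matrix.diagonal_add]; rfl
      rw [this, Matrix.add_mul, Matrix.mul_add, Matrix.mul_add, Matrix.one_mul, Matrix.mul_one, hM,
        Matrix.smul_mul, Matrix.mul_smul, Matrix.mul_smul, ← Matrix.mul_assoc G,
        Matrix.mul_nonsing_inv _ hGu, Matrix.one_mul]
    rw [gram, ← Matrix.det_mul, ← e1, det_transpose_mul_diagonal_mul]
    rfl
  have d1 : HasDerivAt (fun s : ℝ => ∑ f, pluckerWeight N f * ∏ i, (1 + s * b (f i)))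
      (∑ f, pluckerWeight N f * ∑ i, b (f i)) 0 := by
    refine HasDerivAt.fun_sum fun f _ => HasDerivAt.const_mul _ ?_
    have : ∀ i ∈ Finset.univ, HasDerivAt (fun s : ℝ => 1 + s * b (f i)) (b (f i)) 0 := by
      intro i _
      simpa using ((hasDerivAt_id (0 : ℝ)).mul_const (b (f i))).const_add 1
    have := HasDerivAt.fun_finsetProd this
    simpa using this
  have d2 : HasDerivAt (fun s : ℝ => gram N * (1 + s • M).det) (gram N * M.trace) 0 := by
    refine HasDerivAt.const_mul _ ?_
    have : (fun s : ℝ => (1 + s • M).det) = fun s : ℝ => 1 + M.trace * s +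
        ((1 + (Polynomial.X : Polynomial ℝ) • M.map Polynomial.C).det.divX.divX).eval s * s ^ 2 := by
      ext s; rw [Matrix.det_one_add_smul]
    rw [this]
    have a1 : HasDerivAt (fun s : ℝ => 1 + M.trace * s) (M.trace) 0 := by
      simpa using ((hasDerivAt_id (0 : ℝ)).const_mul M.trace).const_add 1
    have a2 := (((1 + (Polynomial.X : Polynomial ℝ) • M.map Polynomial.C).det.divX.divX).hasDerivAt
      (0 : ℝ)).mul ((hasDerivAt_id (0 : ℝ)).pow 2)
    have a3 := a1.add a2
    refine a3.congr_deriv ?_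
    simp
  have d3 := d1.unique (by simpa only [h1] using d2)
  rw [d3, hM]
  congr 1
  rw [colProj, ← hG, Matrix.trace_mul_comm G⁻¹, Matrix.mul_assoc, Matrix.trace_mul_comm Nᵀ]
  simp only [Matrix.mul_assoc]

end Expansion

section Perturbation

variable {n r : ℕ}

lemma prod_exp_sq (b : Fin n → ℝ) (f : Fin r → Fin n) :
    ∏ i, Real.exp (b (f i)) ^ 2 = Real.exp (2 * ∑ i, b (f i)) := by
  rw [Finset.mul_sum, Real.exp_sum]
  refine Finset.prod_congr rfl fun i _ => ?_
  rw [← Real.exp_nat_mul]; norm_num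

lemma gram_exp_mul_eq (N : Matrix (Fin n) (Fin r) ℝ) (b : Fin n → ℝ) :
    gram (diagonal (fun k => Real.exp (b k)) * N) =
      ∑ f, pluckerWeight N f * Real.exp (2 * ∑ i, b (f i)) := by
  simp only [gram_diagonal_mul, prod_exp_sq]

lemma gram_mul_one_add_trace (N : Matrix (Fin n) (Fin r) ℝ) (h : gram N ≠ 0) (b : Fin n → ℝ) :
    gram N * (1 + 2 * (diagonal b * colProj N).trace) =
      ∑ f, pluckerWeight N f * (2 * ∑ i, b (f i) + 1) := by
  have := sum_pluckerWeight_mul_sum N h b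
  have e : ∀ f : Fin r → Fin n, pluckerWeight N f * (2 * ∑ i, b (f i) + 1) =
      pluckerWeight N f + 2 * (pluckerWeight N f * ∑ i, b (f i)) := fun f => by ring
  simp only [e, Finset.sum_add_distrib, ← Finset.mul_sum]
  rw [← gram_eq_sum, this]
  ring

lemma le_gram_exp_mul (N : Matrix (Fin n) (Fin r) ℝ) (h : gram N ≠ 0) (b : Fin n → ℝ) :
    gram N * (1 + 2 * (diagonal b * colProj N).trace) ≤
      gram (diagonal (fun k => Real.exp (b k)) * N) := by
  rw [gram_mul_one_add_trace N h, gram_exp_mul_eq]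
  exact Finset.sum_le_sum fun f _ =>
    mul_le_mul_of_nonneg_left (Real.add_one_le_exp _) (pluckerWeight_nonneg N f)

/-- If the Gram determinant does not grow under `diag (exp b)` although its first variation
vanishes, then the column space is invariant under `diag b`. -/
lemma commute_of_gram_exp_le (N : Matrix (Fin n) (Fin r) ℝ) (h : gram N ≠ 0) (b : Fin n → ℝ)
    (ht : (diagonal b * colProj N).trace = 0)
    (hle : gram (diagonal (fun k => Real.exp (b k)) * N) ≤ gram N) :
    diagonal b * colProj N = colProj N * diagonal b := by
  have hz : ∀ f : Fin r → Fin n, (N.submatrix f id).det ≠ 0 → ∑ i, b (f i) = 0 := by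
    intro f hf
    by_contra hne
    have hw : 0 < pluckerWeight N f := by unfold pluckerWeight; positivity
    have : ∑ f, pluckerWeight N f * (2 * ∑ i, b (f i) + 1) <
        ∑ f, pluckerWeight N f * Real.exp (2 * ∑ i, b (f i)) :=
      Finset.sum_lt_sum (fun f _ =>
        mul_le_mul_of_nonneg_left (Real.add_one_le_exp _) (pluckerWeight_nonneg N f))
        ⟨f, Finset.mem_univ _, mul_lt_mul_of_pos_left
          (Real.add_one_lt_exp (mul_ne_zero two_ne_zero hne)) hw⟩
    rw [← gram_mul_one_add_trace N h, ← gram_exp_mul_eq, ht] at this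
    linarith
  obtain ⟨f, hf⟩ : ∃ f : Fin r → Fin n, (N.submatrix f id).det ≠ 0 := by
    by_contra! hall
    refine h ?_
    rw [gram_eq_sum]
    exact Finset.sum_eq_zero fun f _ => by simp [pluckerWeight, hall f]
  set F := N.submatrix f id with hF
  have hFu : IsUnit F.det := isUnit_iff_ne_zero.mpr hf
  have hR : ∀ k i, (N * F⁻¹) k i ≠ 0 → b k = b (f i) := by
    intro k i hki
    have e : (N.submatrix (Function.update f i k) id).det = (N * F⁻¹) k i * F.det := by
      have e1 : N.submatrix (Function.update f i k) id = F.updateRow i (N k) := by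
        ext a c
        by_cases hac : a = i
        · subst hac; simp
        · simp [hac, hF]
      have e2 : N k = Fᵀ *ᵥ ((N * F⁻¹) k) := by
        have : N = (N * F⁻¹) * F := by
          rw [Matrix.mul_assoc, Matrix.nonsing_inv_mul _ hFu, Matrix.mul_one]
        ext c
        conv_lhs => rw [this]
        simp [Matrix.mul_apply, Matrix.mulVec, dotProduct, mul_comm]
      rw [e1, ← Matrix.cramer_transpose_apply, e2, Matrix.cramer_eq_adjugate_mulVec,
        Matrix.mulVec_mulVec, Matrix.adjugate_mul, Matrix.det_transpose]
      simp [mul_comm, Matrix.smul_mulVec]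
    have h1 := hz (Function.update f i k) (by rw [e]; exact mul_ne_zero hki hf)
    have h2 := hz f hf
    rw [← Finset.add_sum_erase _ _ (Finset.mem_univ i)] at h1 h2
    have h3 : ∑ x ∈ Finset.univ.erase i, b (Function.update f i k x) =
        ∑ x ∈ Finset.univ.erase i, b (f x) :=
      Finset.sum_congr rfl fun x hx => by rw [Function.update_of_ne (Finset.ne_of_mem_erase hx)]
    rw [h3] at h1
    simp only [Function.update_self] at h1
    linarith
  have hb : diagonal b * (N * F⁻¹) = (N * F⁻¹) * diagonal (fun i => b (f i)) := by
    ext k i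
    rw [Matrix.diagonal_mul, Matrix.mul_diagonal]
    by_cases hki : (N * F⁻¹) k i = 0
    · simp [hki]
    · rw [hR k i hki, mul_comm]
  have hN : diagonal b * N = N * (F⁻¹ * diagonal (fun i => b (f i)) * F) := by
    have : N = (N * F⁻¹) * F := by
      rw [Matrix.mul_assoc, Matrix.nonsing_inv_mul _ hFu, Matrix.mul_one]
    conv_lhs => rw [this, ← Matrix.mul_assoc, hb]
    simp only [Matrix.mul_assoc]
  have h1 : colProj N * (diagonal b * colProj N) = diagonal b * colProj N := by
    have : colProj N * (diagonal b * N) = diagonal b * N := by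
      rw [hN, ← Matrix.mul_assoc, colProj_mul_self h]
    conv_rhs => rw [colProj, ← Matrix.mul_assoc, ← Matrix.mul_assoc, ← this]
    simp only [colProj, Matrix.mul_assoc]
  have h2 := congrArg Matrix.transpose h1
  simp only [Matrix.transpose_mul, Matrix.diagonal_transpose, colProj_transpose] at h2
  rw [← h1, ← h2, Matrix.mul_assoc]

lemma exp_neg_mul_gram_le (N : Matrix (Fin n) (Fin r) ℝ) (b : Fin n → ℝ) {B : ℝ}
    (hB : ∀ k, |b k| ≤ B) :
    Real.exp (-(2 * r * B)) * gram N ≤ gram (diagonal (fun k => Real.exp (b k)) * N) := by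
  rw [gram_eq_sum, gram_exp_mul_eq, Finset.mul_sum]
  refine Finset.sum_le_sum fun f _ => ?_
  rw [mul_comm]
  refine mul_le_mul_of_nonneg_left (Real.exp_le_exp.mpr ?_) (pluckerWeight_nonneg N f)
  have : ∑ _i : Fin r, (-B) ≤ ∑ i, b (f i) :=
    Finset.sum_le_sum fun i _ => (abs_le.mp (hB (f i))).1
  simp at this
  linarith

end Perturbation

section Determinants

lemma one_add_sum_le_prod_one_add {α : Type*} (s : Finset α) {f : α → ℝ} (hf : ∀ i, 0 ≤ f i) :
    1 + ∑ i ∈ s, f i ≤ ∏ i ∈ s, (1 + f i) := by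
  induction s using Finset.cons_induction with
  | empty => simp
  | cons a s ha ih =>
    rw [Finset.sum_cons, Finset.prod_cons]
    have := Finset.sum_nonneg fun i (_ : i ∈ s) => hf i
    nlinarith [hf a, mul_nonneg (hf a) this]

variable {ι : Type*} [Fintype ι] [DecidableEq ι]

lemma one_add_trace_le_det {Y : Matrix ι ι ℝ} (hY : Y.PosSemidef) :
    1 + Y.trace ≤ (1 + Y).det := by
  have h : (1 + Y).det = ∏ i, (1 + hY.1.eigenvalues i) := by
    have e : 1 + Y = Unitary.conjStarAlgAut ℝ _ hY.1.eigenvectorUnitary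
        (diagonal fun i => 1 + hY.1.eigenvalues i) := by
      have : (diagonal fun i => 1 + hY.1.eigenvalues i) =
          1 + diagonal (RCLike.ofReal (K := ℝ) ∘ hY.1.eigenvalues) := by
        rw [← Matrix.diagonal_one, Matrix.diagonal_add]; rfl
      rw [this, map_add, map_one, ← hY.1.spectral_theorem]
    rw [e, Unitary.conjStarAlgAut_apply, Matrix.det_mul_right_comm,
      Unitary.mul_star_self_of_mem hY.1.eigenvectorUnitary.2, one_mul, Matrix.det_diagonal]
  have ht : Y.trace = ∑ i, hY.1.eigenvalues i := by
    simpa using hY.1.trace_eq_sum_eigenvalues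
  rw [h, ht]
  exact one_add_sum_le_prod_one_add _ hY.eigenvalues_nonneg

open scoped MatrixOrder Matrix.Norms.L2Operator in
lemma exists_isUnit_transpose_mul_self {S : Matrix ι ι ℝ} (hS : S.PosDef) :
    ∃ C : Matrix ι ι ℝ, IsUnit C.det ∧ S = Cᵀ * C := by
  obtain ⟨C, rfl⟩ := CStarAlgebra.nonneg_iff_eq_star_mul_self.mp hS.posSemidef.nonneg
  refine ⟨C, ?_, ?_⟩
  · have := hS.det_pos
    rw [Matrix.det_mul] at this
    exact isUnit_iff_ne_zero.mpr (right_ne_zero_of_mul this.ne')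
  · rw [Matrix.star_eq_conjTranspose, Matrix.conjTranspose_eq_transpose_of_trivial]

/-- The quantitative monotonicity of the determinant: with `S = CᵀC`,
`det (S + X) ≥ det S * (1 + tr (C⁻ᵀ X C⁻¹))`. -/
lemma det_le_det_add {S X : Matrix ι ι ℝ} (hS : S.PosDef) (hX : X.PosSemidef) :
    S.det ≤ (S + X).det ∧ ((S + X).det ≤ S.det → X = 0) := by
  obtain ⟨C, hC, rfl⟩ := exists_isUnit_transpose_mul_self hS
  have hCt : IsUnit Cᵀ.det := by rwa [Matrix.det_transpose]
  set Y := (C⁻¹)ᵀ * X * C⁻¹ with hYdef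
  have hY : Y.PosSemidef := by
    have := hX.conjTranspose_mul_mul_same C⁻¹
    rwa [Matrix.conjTranspose_eq_transpose_of_trivial] at this
  have hXY : X = Cᵀ * Y * C := by
    rw [hYdef, Matrix.transpose_nonsing_inv]
    simp only [Matrix.mul_assoc]
    rw [Matrix.nonsing_inv_mul _ hC, Matrix.mul_one, ← Matrix.mul_assoc,
      Matrix.mul_nonsing_inv _ hCt, Matrix.one_mul]
  have hdet : (Cᵀ * C + X).det = (Cᵀ * C).det * (1 + Y).det := by
    have : Cᵀ * C + X = Cᵀ * (1 + Y) * C := by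
      rw [Matrix.mul_add, Matrix.add_mul, Matrix.mul_one, ← hXY]
    rw [this]
    simp only [Matrix.det_mul]
    ring
  have h1 := one_add_trace_le_det hY
  have h2 : 0 ≤ Y.trace := hY.trace_nonneg
  have h3 := hS.det_pos
  rw [hdet]
  refine ⟨by nlinarith, fun hle => ?_⟩
  have h4 : Y.trace = 0 := le_antisymm (by nlinarith) h2
  rw [hXY, hY.trace_eq_zero_iff.mp h4]
  simp

end Determinants

section Gram

variable {n : ℕ} {ι κ : Type*} [Fintype ι] [Fintype κ]

lemma posSemidef_transpose_mul_self (N : Matrix κ ι ℝ) : (Nᵀ * N).PosSemidef := by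
  have := Matrix.posSemidef_conjTranspose_mul_self N
  rwa [Matrix.conjTranspose_eq_transpose_of_trivial] at this

lemma mulVec_dotProduct_mulVec {R : Type*} [CommRing R] (N : Matrix κ ι R) (v : ι → R) :
    v ⬝ᵥ ((Nᵀ * N) *ᵥ v) = (N *ᵥ v) ⬝ᵥ (N *ᵥ v) := by
  rw [← Matrix.mulVec_mulVec, Matrix.dotProduct_mulVec, Matrix.vecMul_transpose]

variable [DecidableEq ι] [DecidableEq κ]

lemma gram_nonneg (N : Matrix (Fin n) ι ℝ) : 0 ≤ gram N :=
  (posSemidef_transpose_mul_self N).det_nonneg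

lemma gram_mul_square (N : Matrix (Fin n) ι ℝ) (U : Matrix ι ι ℝ) :
    gram (N * U) = gram N * U.det ^ 2 := by
  have : (N * U)ᵀ * (N * U) = Uᵀ * (Nᵀ * N) * U := by
    simp only [Matrix.transpose_mul, Matrix.mul_assoc]
  rw [gram, this, Matrix.det_mul, Matrix.det_mul, Matrix.det_transpose, gram]
  ring

lemma gram_submatrix (N : Matrix (Fin n) ι ℝ) (e : κ ≃ ι) : gram (N.submatrix id e) = gram N := by
  rw [gram, gram, ← Matrix.det_submatrix_equiv_self e (Nᵀ * N)]
  rfl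

lemma gram_square (N : Matrix (Fin n) (Fin n) ℝ) : gram N = N.det ^ 2 := by
  rw [gram, Matrix.det_mul, Matrix.det_transpose, pow_two]

lemma pow_mul_gram_le {y : Matrix (Fin n) (Fin n) ℝ} {c : ℝ} (hc : 0 ≤ c)
    (hy : ∀ v, c * (v ⬝ᵥ v) ≤ (y *ᵥ v) ⬝ᵥ (y *ᵥ v)) (N : Matrix (Fin n) ι ℝ) :
    c ^ Fintype.card ι * gram N ≤ gram (y * N) := by
  have e : c ^ Fintype.card ι * gram N = (c • (Nᵀ * N)).det := by rw [Matrix.det_smul, gram]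
  rcases eq_or_ne (c ^ Fintype.card ι * gram N) 0 with h0 | h0
  · rw [h0]; exact gram_nonneg _
  have hpd : (c • (Nᵀ * N)).PosDef := by
    refine Matrix.PosSemidef.posDef_iff_det_ne_zero ?_ |>.mpr (e ▸ h0)
    exact (posSemidef_transpose_mul_self N).smul hc
  have hps : ((y * N)ᵀ * (y * N) - c • (Nᵀ * N)).PosSemidef := by
    refine Matrix.PosSemidef.of_dotProduct_mulVec_nonneg ?_ fun v => ?_
    · exact (posSemidef_transpose_mul_self _).1.sub hpd.1
    · rw [star_trivial, Matrix.sub_mulVec, dotProduct_sub, mulVec_dotProduct_mulVec,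
        Matrix.smul_mulVec, dotProduct_smul, mulVec_dotProduct_mulVec, smul_eq_mul,
        ← Matrix.mulVec_mulVec]
      linarith [hy (N *ᵥ v)]
  have := (det_le_det_add hpd hps).1
  rwa [← e, add_sub_cancel] at this

lemma mulVec_dotProduct_self_le (H : Matrix (Fin n) (Fin n) ℝ) (v : Fin n → ℝ) :
    (H *ᵥ v) ⬝ᵥ (H *ᵥ v) ≤ (∑ i, ∑ j, H i j ^ 2) * (v ⬝ᵥ v) := by
  rw [Finset.sum_mul]
  refine Finset.sum_le_sum fun i _ => ?_
  have := Finset.sum_mul_sq_le_sq_mul_sq Finset.univ (H i) v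
  simpa [Matrix.mulVec, dotProduct, pow_two] using this

lemma exists_pos_mul_le {y : Matrix (Fin n) (Fin n) ℝ} (hy : y.det ≠ 0) :
    ∃ c : ℝ, 0 < c ∧ ∀ v, c * (v ⬝ᵥ v) ≤ (y *ᵥ v) ⬝ᵥ (y *ᵥ v) := by
  set F := ∑ i, ∑ j, y⁻¹ i j ^ 2
  have hF : 0 ≤ F := Finset.sum_nonneg fun i _ => Finset.sum_nonneg fun j _ => sq_nonneg _
  refine ⟨(F + 1)⁻¹, by positivity, fun v => ?_⟩
  have h := mulVec_dotProduct_self_le y⁻¹ (y *ᵥ v)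
  rw [Matrix.mulVec_mulVec, Matrix.nonsing_inv_mul _ (isUnit_iff_ne_zero.mpr hy),
    Matrix.one_mulVec] at h
  have h0 : 0 ≤ (y *ᵥ v) ⬝ᵥ (y *ᵥ v) := Finset.sum_nonneg fun i _ => mul_self_nonneg _
  rw [inv_mul_le_iff₀ (by positivity)]
  linarith

lemma one_sub_mul_le {M : Matrix (Fin n) (Fin n) ℝ} {t : ℝ} (ht : 0 < t)
    (hM : ∑ i, ∑ j, (M - 1) i j ^ 2 ≤ t ^ 2) (v : Fin n → ℝ) :
    (1 - 2 * t) * (v ⬝ᵥ v) ≤ (M *ᵥ v) ⬝ᵥ (M *ᵥ v) := by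
  set w := (M - 1) *ᵥ v with hw
  have hv : 0 ≤ v ⬝ᵥ v := Finset.sum_nonneg fun i _ => mul_self_nonneg _
  have e : M *ᵥ v = v + w := by rw [hw, Matrix.sub_mulVec, Matrix.one_mulVec]; abel
  have h1 : w ⬝ᵥ w ≤ t ^ 2 * (v ⬝ᵥ v) :=
    (mulVec_dotProduct_self_le _ _).trans (mul_le_mul_of_nonneg_right hM hv)
  have h2 : 0 ≤ (t • v + w) ⬝ᵥ (t • v + w) := Finset.sum_nonneg fun i _ => mul_self_nonneg _
  have h3 : 0 ≤ w ⬝ᵥ w := Finset.sum_nonneg fun i _ => mul_self_nonneg _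
  rw [e]
  simp only [dotProduct_add, add_dotProduct, smul_dotProduct, dotProduct_smul, smul_eq_mul,
    dotProduct_comm w v] at h2 ⊢
  have h4 : 0 ≤ t * (2 * t * (v ⬝ᵥ v) + 2 * (v ⬝ᵥ w)) := by nlinarith
  have h5 := nonneg_of_mul_nonneg_right h4 ht
  linarith

end Gram

section Integral

variable {n : ℕ} {ι κ : Type*} [Fintype ι] [Fintype κ]

/-- The columns of the integer matrix `m` are linearly independent. -/
def IntInj (m : Matrix (Fin n) ι ℤ) : Prop := ∀ z : ι → ℤ, m *ᵥ z = 0 → z = 0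

/-- An integer matrix seen as a real matrix. -/
def realMat (m : Matrix (Fin n) ι ℤ) : Matrix (Fin n) ι ℝ := m.map (Int.cast : ℤ → ℝ)

lemma intInj_iff {m : Matrix (Fin n) ι ℤ} : IntInj m ↔ LinearIndependent ℤ m.col := by
  rw [← Matrix.mulVec_injective_iff]
  exact (injective_iff_map_eq_zero m.mulVecLin).symm

lemma IntInj.submatrix {m : Matrix (Fin n) ι ℤ} (hm : IntInj m) {e : κ → ι}
    (he : Function.Injective e) : IntInj (m.submatrix id e) :=
  intInj_iff.mpr ((intInj_iff.mp hm).comp e he)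

lemma IntInj.card_le {m : Matrix (Fin n) ι ℤ} (hm : IntInj m) : Fintype.card ι ≤ n := by
  have : Function.Injective m.mulVecLin := by
    rw [injective_iff_map_eq_zero]; exact hm
  simpa using LinearMap.finrank_le_finrank_of_injective this

variable [DecidableEq ι] [DecidableEq κ]

lemma one_le_gram_realMat {m : Matrix (Fin n) ι ℤ} (hm : IntInj m) : 1 ≤ gram (realMat m) := by
  have e : gram (realMat m) = ((mᵀ * m).det : ℤ) := by
    have := (Int.castRingHom ℝ).map_det (mᵀ * m)
    rw [eq_intCast] at this
    rw [this, gram]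
    congr 1
    ext i j
    simp [realMat, Matrix.mul_apply]
  have h0 : (mᵀ * m).det ≠ 0 := by
    intro h
    obtain ⟨z, hz, hz0⟩ := Matrix.exists_mulVec_eq_zero_iff.mpr h
    refine hz (hm z ?_)
    have h1 : (m *ᵥ z) ⬝ᵥ (m *ᵥ z) = 0 := by
      rw [← mulVec_dotProduct_mulVec, hz0, dotProduct_zero]
    exact dotProduct_self_eq_zero.mp h1
  have h1 := gram_nonneg (realMat m)
  rw [e] at h1 ⊢
  have h2 : 0 ≤ (mᵀ * m).det := by exact_mod_cast h1
  have h3 : 1 ≤ (mᵀ * m).det := by omega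
  exact_mod_cast h3

lemma gram_mul_realMat_pos {y : Matrix (Fin n) (Fin n) ℝ} (hy : y.det ≠ 0)
    {m : Matrix (Fin n) ι ℤ} (hm : IntInj m) : 0 < gram (y * realMat m) := by
  obtain ⟨c, hc, h⟩ := exists_pos_mul_le hy
  have := one_le_gram_realMat hm
  exact lt_of_lt_of_le (by positivity) (pow_mul_gram_le hc.le h _)

/-- All subgroups of `yℤⁿ` of rank `r` have covolume at least `c ^ r`. -/
def Good (y : Matrix (Fin n) (Fin n) ℝ) (c : ℝ) : Prop :=
  ∀ (r : ℕ) (m : Matrix (Fin n) (Fin r) ℤ), IntInj m → c ^ (2 * r) ≤ gram (y * realMat m)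

lemma Good.le_gram {y : Matrix (Fin n) (Fin n) ℝ} {c : ℝ} (h : Good y c)
    {m : Matrix (Fin n) ι ℤ} (hm : IntInj m) :
    c ^ (2 * Fintype.card ι) ≤ gram (y * realMat m) := by
  have e := (Fintype.equivFin ι).symm
  have := h _ _ (hm.submatrix e.injective)
  rwa [← gram_submatrix (y * realMat m) e]

lemma Good.mono {y : Matrix (Fin n) (Fin n) ℝ} {c c' : ℝ} (h : Good y c) (h0 : 0 ≤ c')
    (hc : c' ≤ c) : Good y c' :=
  fun r m hm => (pow_le_pow_left₀ h0 hc _).trans (h r m hm)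

lemma exists_good {y : Matrix (Fin n) (Fin n) ℝ} (hy : y.det ≠ 0) : ∃ c, 0 < c ∧ Good y c := by
  obtain ⟨c, hc, h⟩ := exists_pos_mul_le hy
  refine ⟨√c, Real.sqrt_pos.mpr hc, fun r m hm => ?_⟩
  rw [pow_mul, Real.sq_sqrt hc.le]
  have h1 := pow_mul_gram_le hc.le h (realMat m)
  have h2 := one_le_gram_realMat hm
  rw [Fintype.card_fin] at h1
  exact le_trans (le_mul_of_one_le_right (by positivity) h2) h1

lemma Good.mul_left {y M : Matrix (Fin n) (Fin n) ℝ} {c d : ℝ} (h : Good y c) (hd : 0 ≤ d)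
    (hM : ∀ v, d ^ 2 * (v ⬝ᵥ v) ≤ (M *ᵥ v) ⬝ᵥ (M *ᵥ v)) : Good (M * y) (d * c) := by
  intro r m hm
  have h1 := pow_mul_gram_le (sq_nonneg d) hM (y * realMat m)
  rw [Fintype.card_fin, ← Matrix.mul_assoc, ← pow_mul] at h1
  rw [mul_pow]
  exact le_trans (mul_le_mul_of_nonneg_left (h r m hm) (by positivity)) h1

end Integral

section Plucker

variable {n r : ℕ}

/-- The Plücker coordinates of the subgroup of `ℤⁿ` spanned by the columns of `m`. -/
def plucker (m : Matrix (Fin n) (Fin r) ℤ) : Σ r : ℕ, ((Fin r → Fin n) → ℤ) :=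
  ⟨r, fun f => (m.submatrix f id).det⟩

/-- The Gram determinant of `y * m` in terms of the Plücker coordinates of `m`. -/
def pluckerGram (y : Matrix (Fin n) (Fin n) ℝ) (p : Σ r : ℕ, ((Fin r → Fin n) → ℤ)) : ℝ :=
  ∑ f : Fin p.1 → Fin n, (∑ g : Fin p.1 → Fin n, (∏ i, y (f i) (g i)) * p.2 g) ^ 2 /
    (p.1.factorial : ℝ)

lemma det_realMat_submatrix (m : Matrix (Fin n) (Fin r) ℤ) (f : Fin r → Fin n) :
    ((realMat m).submatrix f id).det = ((m.submatrix f id).det : ℤ) := by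
  have := (Int.castRingHom ℝ).map_det (m.submatrix f id)
  rw [eq_intCast] at this
  rw [this]
  rfl

lemma gram_mul_realMat_eq (y : Matrix (Fin n) (Fin n) ℝ) (m : Matrix (Fin n) (Fin r) ℤ) :
    gram (y * realMat m) = pluckerGram y (plucker m) := by
  rw [gram_eq_sum]
  refine Finset.sum_congr rfl fun f _ => ?_
  have : (y * realMat m).submatrix f id = y.submatrix f id * realMat m := rfl
  rw [pluckerWeight, this, det_mul_eq_sum]
  simp only [det_realMat_submatrix]
  rfl

/-- Only finitely many sublattices of `yℤⁿ` have bounded covolume. -/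
lemma finite_plucker_gram_le {y : Matrix (Fin n) (Fin n) ℝ} (hy : y.det ≠ 0) (B : ℝ) :
    {p | ∃ (r : ℕ) (m : Matrix (Fin n) (Fin r) ℤ), IntInj m ∧ plucker m = p ∧
      gram (y * realMat m) ≤ B}.Finite := by
  obtain ⟨c, hc, h⟩ := exists_pos_mul_le hy
  let C : ℕ → ℤ := fun r => ⌈r.factorial * (B / c ^ r)⌉
  refine Set.Finite.subset (Set.Finite.biUnion (Set.finite_Iic n) fun r _ =>
    (Set.finite_Icc (fun _ => -C r : (Fin r → Fin n) → ℤ) (fun _ => C r)).image (Sigma.mk r)) ?_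
  rintro _ ⟨r, m, hm, rfl, hB⟩
  refine Set.mem_biUnion (x := r) (by simpa using hm.card_le) ⟨_, ?_, rfl⟩
  have key : ∀ f : Fin r → Fin n, |(m.submatrix f id).det| ≤ C r := by
    intro f
    have h1 := pow_mul_gram_le hc.le h (realMat m)
    rw [Fintype.card_fin] at h1
    have h2 : gram (realMat m) ≤ B / c ^ r := by
      rw [le_div_iff₀ (by positivity), mul_comm]; exact h1.trans hB
    have h3 : pluckerWeight (realMat m) f ≤ gram (realMat m) := by
      rw [gram_eq_sum]
      exact Finset.single_le_sum (fun g _ => pluckerWeight_nonneg (realMat m) g)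
        (Finset.mem_univ f)
    rw [pluckerWeight, det_realMat_submatrix, div_le_iff₀ (by positivity)] at h3
    have h4 : (((m.submatrix f id).det ^ 2 : ℤ) : ℝ) ≤ C r := by
      rw [Int.cast_pow]
      refine (h3.trans ?_).trans (Int.le_ceil _)
      rw [mul_comm]
      exact mul_le_mul_of_nonneg_left h2 (by positivity)
    have h5 : (m.submatrix f id).det ^ 2 ≤ C r := by exact_mod_cast h4
    rw [← sq_abs] at h5
    exact (Int.le_self_sq _).trans h5
  exact ⟨fun f => (abs_le.mp (key f)).1, fun f => (abs_le.mp (key f)).2⟩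

/-- The (Plücker coordinates of) subgroups of `yℤⁿ` of covolume exactly `c ^ r`. -/
def extremal (y : Matrix (Fin n) (Fin n) ℝ) (c : ℝ) : Set (Σ r : ℕ, ((Fin r → Fin n) → ℤ)) :=
  {p | ∃ (r : ℕ) (m : Matrix (Fin n) (Fin r) ℤ), IntInj m ∧ plucker m = p ∧
    gram (y * realMat m) = c ^ (2 * r)}

lemma mem_extremal_iff {y : Matrix (Fin n) (Fin n) ℝ} {c : ℝ} {m : Matrix (Fin n) (Fin r) ℤ}
    (hm : IntInj m) : plucker m ∈ extremal y c ↔ gram (y * realMat m) = c ^ (2 * r) := by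
  refine ⟨?_, fun h => ⟨r, m, hm, rfl, h⟩⟩
  rintro ⟨r', m', -, e, h⟩
  rw [gram_mul_realMat_eq] at h ⊢
  have hr : r' = r := congrArg Sigma.fst e
  rw [← e, h, hr]

lemma finite_extremal {y : Matrix (Fin n) (Fin n) ℝ} (hy : y.det ≠ 0) {c : ℝ} (h0 : 0 ≤ c)
    (h1 : c ≤ 1) : (extremal y c).Finite := by
  refine (finite_plucker_gram_le hy 1).subset ?_
  rintro _ ⟨r, m, hm, rfl, h⟩
  exact ⟨r, m, hm, rfl, h.le.trans (pow_le_one₀ h0 h1)⟩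

lemma exists_gap {y : Matrix (Fin n) (Fin n) ℝ} (hy : y.det ≠ 0) {c : ℝ} (h0 : 0 < c)
    (h1 : c ≤ 1) (hG : Good y c) :
    ∃ η : ℝ, 0 < η ∧ ∀ (r : ℕ) (m : Matrix (Fin n) (Fin r) ℤ), IntInj m →
      gram (y * realMat m) = c ^ (2 * r) ∨ (1 + η) * c ^ (2 * r) ≤ gram (y * realMat m) := by
  let val : (Σ r : ℕ, ((Fin r → Fin n) → ℤ)) → ℝ := fun p => pluckerGram y p / c ^ (2 * p.1)
  let T : Set ℝ := insert 2 {t | t ∈ val '' {p | ∃ (r : ℕ) (m : Matrix (Fin n) (Fin r) ℤ),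
    IntInj m ∧ plucker m = p ∧ gram (y * realMat m) ≤ 2} ∧ 1 < t}
  have hT : T.Finite := Set.Finite.insert _
    (((finite_plucker_gram_le hy 2).image val).subset fun t ht => ht.1)
  obtain ⟨t, htT, ht⟩ := Set.exists_min_image T id hT ⟨2, Set.mem_insert _ _⟩
  have ht1 : 1 < t := by
    rcases htT with rfl | h
    · norm_num
    · exact h.2
  refine ⟨t - 1, by linarith, fun r m hm => ?_⟩
  have hc : 0 < c ^ (2 * r) := by positivity
  rcases (hG r m hm).eq_or_lt with h | h
  · exact Or.inl h.symm
  right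
  rw [add_sub_cancel, ← le_div_iff₀ hc]
  rcases le_or_gt (gram (y * realMat m)) 2 with h2 | h2
  · refine ht _ (Set.mem_insert_of_mem _ ⟨⟨plucker m, ⟨r, m, hm, rfl, h2⟩, ?_⟩, ?_⟩)
    · rw [gram_mul_realMat_eq]; rfl
    · rwa [one_lt_div hc]
  · refine (ht 2 (Set.mem_insert _ _)).trans ?_
    rw [id, le_div_iff₀ hc]
    have : c ^ (2 * r) ≤ 1 := pow_le_one₀ h0.le h1
    linarith

end Plucker

section Split

/-- The kernel of a homomorphism from `ℤʳ` to a torsion-free group is a direct summand. -/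
lemma exists_unimodular_split {r : ℕ} {V : Type*} [AddCommGroup V] [Module.IsTorsionFree ℤ V]
    (φ : (Fin r → ℤ) →ₗ[ℤ] V) :
    ∃ (a b : ℕ) (e : Fin a ⊕ Fin b ≃ Fin r) (U : Matrix (Fin r) (Fin r) ℤ), IsUnit U.det ∧
      (∀ z, φ (U.submatrix id (e ∘ Sum.inl) *ᵥ z) = 0) ∧
      ∀ z, φ (U.submatrix id (e ∘ Sum.inr) *ᵥ z) = 0 → z = 0 := by
  let Q := (Fin r → ℤ) ⧸ LinearMap.ker φ
  have : Module.IsTorsionFree ℤ Q :=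
    (LinearMap.quotKerEquivRange φ).injective.moduleIsTorsionFree _ (map_smul _)
  have : Module.Free ℤ Q := Module.free_of_finite_type_torsion_free'
  let bI := Module.finBasis ℤ (LinearMap.ker φ)
  let bQ := Module.finBasis ℤ Q
  let B := Module.Basis.sumQuot bI bQ
  let e : _ ⊕ _ ≃ Fin r := B.indexEquiv (Pi.basisFun ℤ (Fin r))
  let U : Matrix (Fin r) (Fin r) ℤ := (Pi.basisFun ℤ (Fin r)).toMatrix (B.reindex e)
  have hU : ∀ k s, U k (e s) = B s k := by
    intro k s
    simp [U, Module.Basis.toMatrix_apply]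
  have hsum : ∀ {ι : Type} [Fintype ι] (f : ι → _) (z : ι → ℤ),
      U.submatrix id (e ∘ f) *ᵥ z = ∑ i, z i • B (f i) := by
    intro ι _ f z
    ext k
    simp [Matrix.mulVec, dotProduct, hU, Finset.sum_apply, mul_comm]
  refine ⟨_, _, e, U, (Pi.basisFun ℤ (Fin r)).isUnit_det (B.reindex e), fun z => ?_, fun z hz => ?_⟩
  · rw [hsum, map_sum]
    refine Finset.sum_eq_zero fun i _ => ?_
    rw [map_smul, Module.Basis.sumQuot_inl, LinearMap.map_coe_ker, smul_zero]
  · rw [hsum, ← LinearMap.mem_ker, ← Submodule.Quotient.mk_eq_zero] at hz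
    have h : ∑ i, z i • bQ i = 0 := by
      rw [← hz, ← Submodule.mkQ_apply, map_sum]
      refine Finset.sum_congr rfl fun i _ => ?_
      rw [map_smul, Submodule.mkQ_apply, Module.Basis.sumQuot_inr]
    exact funext (Fintype.linearIndependent_iff.mp bQ.linearIndependent z h)

end Split

section Schur

variable {n : ℕ} {ι κ : Type*}

lemma mul_eq_zero_of_idempotent {Q : Matrix (Fin n) (Fin n) ℝ} (hs : Qᵀ = Q) (hQ : Q * Q = Q)
    {K : Matrix (Fin n) κ ℝ} (h : Kᵀ * Q * K = 0) : Q * K = 0 := by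
  have : (Q * K)ᴴ * (Q * K) = 0 := by
    rw [Matrix.conjTranspose_eq_transpose_of_trivial, Matrix.transpose_mul, hs, Matrix.mul_assoc,
      ← Matrix.mul_assoc Q, hQ, ← Matrix.mul_assoc, h]
  exact Matrix.conjTranspose_mul_self_eq_zero.mp this

variable [Fintype κ]

lemma posSemidef_of_idempotent {Q : Matrix (Fin n) (Fin n) ℝ} (hs : Qᵀ = Q) (hQ : Q * Q = Q)
    (K : Matrix (Fin n) κ ℝ) : (Kᵀ * Q * K).PosSemidef := by
  have : Kᵀ * Q * K = (Q * K)ᵀ * (Q * K) := by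
    rw [Matrix.transpose_mul, hs, Matrix.mul_assoc, Matrix.mul_assoc, ← Matrix.mul_assoc Q, hQ]
  rw [this]
  exact posSemidef_transpose_mul_self _

variable [Fintype ι] [DecidableEq ι] [DecidableEq κ]

lemma gram_fromCols (N : Matrix (Fin n) ι ℝ) (K : Matrix (Fin n) κ ℝ) (h : gram N ≠ 0) :
    gram (Matrix.fromCols N K) = gram N * (Kᵀ * (1 - colProj N) * K).det := by
  have : Invertible (Nᵀ * N) := Matrix.invertibleOfIsUnitDet _ (isUnit_iff_ne_zero.mpr h)
  rw [gram, Matrix.transpose_fromCols, Matrix.fromRows_mul_fromCols, Matrix.det_fromBlocks₁₁, gram,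
    Matrix.invOf_eq_nonsing_inv]
  congr 2
  simp only [colProj, Matrix.mul_sub, Matrix.sub_mul, Matrix.mul_one, Matrix.mul_assoc]

/-- Comparison of the Schur complements of two nested column spaces. -/
lemma colProj_mul_eq_of_det_le {T : Matrix (Fin n) ι ℝ} (hT : gram T ≠ 0) {μ : Type*} [Fintype μ]
    [DecidableEq μ] {N : Matrix (Fin n) μ ℝ} (hN : gram N ≠ 0) (hTN : colProj T * N = N)
    (K : Matrix (Fin n) κ ℝ) (hpos : (Kᵀ * (1 - colProj T) * K).det ≠ 0)
    (hle : (Kᵀ * (1 - colProj N) * K).det ≤ (Kᵀ * (1 - colProj T) * K).det) :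
    colProj T * K = colProj N * K := by
  have h1 : colProj T * colProj N = colProj N := mul_colProj_of_mul_eq hTN
  have h2 : colProj N * colProj T = colProj N := by
    have := congrArg Matrix.transpose h1
    rwa [Matrix.transpose_mul, colProj_transpose, colProj_transpose] at this
  have hTT := colProj_mul_colProj hT
  have hNN := colProj_mul_colProj hN
  have hQ : (colProj T - colProj N) * (colProj T - colProj N) = colProj T - colProj N := by
    rw [Matrix.sub_mul, Matrix.mul_sub, Matrix.mul_sub, hTT, h1, h2, hNN, sub_self, sub_zero]
  have hQs : (colProj T - colProj N)ᵀ = colProj T - colProj N := by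
    rw [Matrix.transpose_sub, colProj_transpose, colProj_transpose]
  have hR : (1 - colProj T) * (1 - colProj T) = 1 - colProj T := by
    simp [Matrix.sub_mul, Matrix.mul_sub, hTT]
  have hRs : (1 - colProj T)ᵀ = 1 - colProj T := by
    rw [Matrix.transpose_sub, colProj_transpose, Matrix.transpose_one]
  have hS := (posSemidef_of_idempotent hRs hR K).posDef_iff_det_ne_zero.mpr hpos
  have hX := posSemidef_of_idempotent hQs hQ K
  have e : Kᵀ * (1 - colProj T) * K + Kᵀ * (colProj T - colProj N) * K =
      Kᵀ * (1 - colProj N) * K := by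
    rw [← Matrix.add_mul, ← Matrix.mul_add, sub_add_sub_cancel]
  have h0 := mul_eq_zero_of_idempotent hQs hQ ((det_le_det_add hS hX).2 (by rwa [e]))
  rwa [Matrix.sub_mul, sub_eq_zero] at h0

end Schur
section Commutation

variable {n : ℕ}

lemma realMat_mul {ι κ : Type*} [Fintype ι] (m : Matrix (Fin n) ι ℤ) (U : Matrix ι κ ℤ) :
    realMat (m * U) = realMat m * U.map (Int.cast : ℤ → ℝ) := by
  ext i j
  simp [realMat, Matrix.mul_apply]

lemma realMat_mulVec {ι : Type*} [Fintype ι] (m : Matrix (Fin n) ι ℤ) (z : ι → ℤ) :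
    realMat m *ᵥ (fun i => (z i : ℝ)) = fun k => ((m *ᵥ z) k : ℝ) := by
  ext i
  simp [realMat, Matrix.mulVec, dotProduct]

/-- The subgroups of `yℤⁿ` of minimal normalised covolume have commuting projections, and their
sum is contained in another such subgroup. -/
lemma exists_join {y : Matrix (Fin n) (Fin n) ℝ} (hy : y.det ≠ 0) {c : ℝ} (hc : 0 < c)
    (hG : Good y c) {r₁ r₂ : ℕ} {m₁ : Matrix (Fin n) (Fin r₁) ℤ} {m₂ : Matrix (Fin n) (Fin r₂) ℤ}
    (hm₁ : IntInj m₁) (hm₂ : IntInj m₂) (h₁ : gram (y * realMat m₁) = c ^ (2 * r₁))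
    (h₂ : gram (y * realMat m₂) = c ^ (2 * r₂)) :
    colProj (y * realMat m₁) * colProj (y * realMat m₂) =
      colProj (y * realMat m₂) * colProj (y * realMat m₁) ∧
    ∃ (r : ℕ) (m : Matrix (Fin n) (Fin r) ℤ), IntInj m ∧
      gram (y * realMat m) = c ^ (2 * r) ∧
      colProj (y * realMat m) * colProj (y * realMat m₁) = colProj (y * realMat m₁) ∧
      colProj (y * realMat m) * colProj (y * realMat m₂) = colProj (y * realMat m₂) := by
  set T := y * realMat m₁ with hTdef
  set T₂ := y * realMat m₂ with hT₂def
  have hT : gram T ≠ 0 := (gram_mul_realMat_pos hy hm₁).ne'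
  let L : (Fin r₂ → ℤ) →ₗ[ℤ] (Fin n → ℝ) :=
    AddMonoidHom.toIntLinearMap
      { toFun := fun z => ((1 - colProj T) * T₂) *ᵥ (fun i => (z i : ℝ))
        map_zero' := by ext i; simp [Matrix.mulVec]
        map_add' := fun z w => by
          rw [← Matrix.mulVec_add]; congr 1; ext i; simp }
  have hL : ∀ z, L z = ((1 - colProj T) * T₂) *ᵥ (fun i => (z i : ℝ)) := fun z => rfl
  obtain ⟨a, b, e, U, hU, hker, hinj⟩ := exists_unimodular_split L
  set UR : Matrix (Fin r₂) (Fin r₂) ℝ := U.map (Int.cast : ℤ → ℝ) with hUR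
  have hURdet : UR.det ^ 2 = 1 := by
    have : UR.det = (U.det : ℝ) := ((Int.castRingHom ℝ).map_det U).symm
    rw [this]
    rcases Int.isUnit_iff.mp hU with h | h <;> simp [h]
  have hURu : IsUnit UR.det := by
    refine isUnit_iff_ne_zero.mpr fun h => ?_
    rw [h] at hURdet; norm_num at hURdet
  set N := (T₂ * UR).submatrix id (e ∘ Sum.inl) with hNdef
  set K := (T₂ * UR).submatrix id (e ∘ Sum.inr) with hKdef
  have hNK : Matrix.fromCols N K = (T₂ * UR).submatrix id e := by
    ext i (j | j) <;> rfl
  set u := (m₂ * U).submatrix id (e ∘ Sum.inl) with hu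
  set k := (m₂ * U).submatrix id (e ∘ Sum.inr) with hk
  have hNu : N = y * realMat u := by
    have : T₂ * UR = y * realMat (m₂ * U) := by rw [realMat_mul, hT₂def, Matrix.mul_assoc]
    rw [hNdef, this]; rfl
  have hKk : K = y * realMat k := by
    have : T₂ * UR = y * realMat (m₂ * U) := by rw [realMat_mul, hT₂def, Matrix.mul_assoc]
    rw [hKdef, this]; rfl
  have huinj : IntInj u := by
    have : IntInj (m₂ * U) := by
      intro z hz
      rw [← Matrix.mulVec_mulVec] at hz
      have h := hm₂ _ hz
      have h' := congrArg (U⁻¹ *ᵥ ·) h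
      simpa [Matrix.mulVec_mulVec, Matrix.nonsing_inv_mul _ hU] using h'
    exact this.submatrix (e.injective.comp Sum.inl_injective)
  have hN : gram N ≠ 0 := hNu ▸ (gram_mul_realMat_pos hy huinj).ne'
  have hLU : ∀ {l : ℕ} (f : Fin l → Fin r₂) (z : Fin l → ℤ), L (U.submatrix id f *ᵥ z) =
      ((1 - colProj T) * (T₂ * UR).submatrix id f) *ᵥ (fun i => (z i : ℝ)) := by
    intro l f z
    have h : (fun i => ((U.submatrix id f *ᵥ z) i : ℝ)) =
        UR.submatrix id f *ᵥ (fun i => (z i : ℝ)) := by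
      ext i
      simp [Matrix.mulVec, dotProduct, hUR]
    rw [hL, h, Matrix.mulVec_mulVec, Matrix.mul_assoc]
    rfl
  have hTN : colProj T * N = N := by
    have h : (1 - colProj T) * N = 0 := by
      ext i j
      have h1 := hker (Pi.single j 1)
      rw [hLU] at h1
      have h2 : (fun i => ((Pi.single j 1 : Fin a → ℤ) i : ℝ)) = Pi.single j 1 := by
        ext i
        by_cases hij : i = j
        · subst hij; simp
        · simp [hij]
      rw [h2, Matrix.mulVec_single_one] at h1
      exact congrFun h1 i
    rwa [Matrix.sub_mul, Matrix.one_mul, sub_eq_zero, eq_comm] at h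
  have hTT : (1 - colProj T) * T = 0 := by
    rw [Matrix.sub_mul, Matrix.one_mul, colProj_mul_self hT, sub_self]
  have hmk : IntInj (Matrix.fromCols m₁ k) := by
    intro w hw
    rw [Matrix.fromCols_mulVec] at hw
    have h1 : T *ᵥ (fun i => (w (Sum.inl i) : ℝ)) + K *ᵥ (fun i => (w (Sum.inr i) : ℝ)) = 0 := by
      rw [hKk, hTdef, ← Matrix.mulVec_mulVec, ← Matrix.mulVec_mulVec, ← Matrix.mulVec_add]
      have h3 := realMat_mulVec m₁ (w ∘ Sum.inl)
      have h4 := realMat_mulVec k (w ∘ Sum.inr)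
      simp only [Function.comp_apply] at h3 h4
      rw [h3, h4]
      have : ((fun i => ((m₁ *ᵥ (w ∘ Sum.inl)) i : ℝ)) + fun i => ((k *ᵥ (w ∘ Sum.inr)) i : ℝ)) =
          0 := by
        ext i
        have := congrFun hw i
        simp only [Pi.add_apply, Pi.zero_apply] at this ⊢
        exact_mod_cast this
      rw [this, Matrix.mulVec_zero]
    have h2 := congrArg ((1 - colProj T) *ᵥ ·) h1
    simp only [Matrix.mulVec_add, Matrix.mulVec_mulVec, hTT, Matrix.zero_mulVec, zero_add,
      Matrix.mulVec_zero] at h2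
    have h3 : w ∘ Sum.inr = 0 := hinj _ (by rw [hLU]; exact h2)
    rw [h3, Matrix.mulVec_zero, add_zero] at hw
    have h4 := hm₁ _ hw
    ext (i | i)
    · exact congrFun h4 i
    · exact congrFun h3 i
  have hTK : Matrix.fromCols T K = y * realMat (Matrix.fromCols m₁ k) := by
    have : realMat (Matrix.fromCols m₁ k) = Matrix.fromCols (realMat m₁) (realMat k) := by
      ext i (j | j) <;> rfl
    rw [this, Matrix.mul_fromCols, hKk]
  have hD₁ : c ^ (2 * b) ≤ (Kᵀ * (1 - colProj T) * K).det := by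
    have h := hG.le_gram hmk
    rw [← hTK, gram_fromCols T K hT, h₁, Fintype.card_sum, Fintype.card_fin, Fintype.card_fin,
      mul_add, pow_add] at h
    exact le_of_mul_le_mul_left h (by positivity)
  have hD₀ : (Kᵀ * (1 - colProj N) * K).det ≤ c ^ (2 * b) := by
    have h := hG _ _ huinj
    have hr : r₂ = a + b := by simpa using (Fintype.card_congr e).symm
    have h' : gram N * (Kᵀ * (1 - colProj N) * K).det = c ^ (2 * a) * c ^ (2 * b) := by
      rw [← gram_fromCols N K hN, hNK, gram_submatrix, gram_mul_square, h₂, hURdet, mul_one,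
        ← pow_add, ← mul_add, hr]
    rw [← hNu] at h
    by_contra! hlt
    have h3 : 0 < c ^ (2 * b) := by positivity
    have h4 : 0 < gram N := lt_of_lt_of_le (by positivity) h
    nlinarith [mul_le_mul_of_nonneg_right h h3.le, mul_lt_mul_of_pos_left hlt h4]
  have hpos : (Kᵀ * (1 - colProj T) * K).det ≠ 0 := (lt_of_lt_of_le (by positivity) hD₁).ne'
  have hKeq := colProj_mul_eq_of_det_le hT hN hTN K hpos (hD₀.trans hD₁)
  -- a left multiplication is determined by its effect on the columns of `N` and `K`
  have hext : ∀ A B : Matrix (Fin n) (Fin n) ℝ, A * N = B * N → A * K = B * K →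
      A * T₂ = B * T₂ := by
    intro A B hA hB
    have h : A * (T₂ * UR) = B * (T₂ * UR) := by
      have h3 : (A * (T₂ * UR)).submatrix id e = (B * (T₂ * UR)).submatrix id e := by
        have h4 : ∀ C : Matrix (Fin n) (Fin n) ℝ, (C * (T₂ * UR)).submatrix id e =
            Matrix.fromCols (C * N) (C * K) := by
          intro C
          rw [← Matrix.mul_fromCols, hNK]; rfl
        rw [h4, h4, hA, hB]
      ext i j
      simpa using congrFun (congrFun h3 i) (e.symm j)
    rw [← Matrix.mul_assoc, ← Matrix.mul_assoc] at h
    have := congrArg (· * UR⁻¹) h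
    simpa only [Matrix.mul_assoc, Matrix.mul_nonsing_inv _ hURu, Matrix.mul_one] using this
  have hT₂ : gram T₂ ≠ 0 := (gram_mul_realMat_pos hy hm₂).ne'
  have hPT₂ : colProj T * T₂ = colProj N * T₂ :=
    hext _ _ (by rw [hTN, colProj_mul_self hN]) hKeq
  have hT₂N : colProj T₂ * N = N := by
    have : colProj T₂ * (T₂ * UR) = T₂ * UR := by rw [← Matrix.mul_assoc, colProj_mul_self hT₂]
    conv_rhs => rw [hNdef, ← this]
    rfl
  have h20 : colProj T₂ * colProj N = colProj N := mul_colProj_of_mul_eq hT₂N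
  have h02 : colProj N * colProj T₂ = colProj N := by
    have := congrArg Matrix.transpose h20
    rwa [Matrix.transpose_mul, colProj_transpose, colProj_transpose] at this
  have h12 : colProj T * colProj T₂ = colProj N := by
    rw [mul_colProj_congr hPT₂, h02]
  have h21 : colProj T₂ * colProj T = colProj N := by
    have := congrArg Matrix.transpose h12
    rwa [Matrix.transpose_mul, colProj_transpose, colProj_transpose, colProj_transpose] at this
  set J := (Matrix.fromCols T K).submatrix id finSumFinEquiv.symm with hJdef
  have hJ : y * realMat ((Matrix.fromCols m₁ k).submatrix id finSumFinEquiv.symm) = J := by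
    rw [hJdef, hTK]; rfl
  have hJgram : gram J = c ^ (2 * (r₁ + b)) := by
    have hDD : (Kᵀ * (1 - colProj T) * K).det = (Kᵀ * (1 - colProj N) * K).det := by
      rw [Matrix.mul_assoc, Matrix.mul_assoc, Matrix.sub_mul, Matrix.sub_mul, hKeq]
    rw [hJdef, gram_submatrix, gram_fromCols T K hT, h₁, le_antisymm (hDD ▸ hD₀) hD₁, ← pow_add,
      mul_add]
  have hJ0 : gram J ≠ 0 := hJgram ▸ (by positivity)
  have hJTK : colProj J * Matrix.fromCols T K = Matrix.fromCols T K := by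
    have h : colProj J * J = J := colProj_mul_self hJ0
    have hsub : J.submatrix id finSumFinEquiv = Matrix.fromCols T K := by
      simp [hJdef, Matrix.submatrix_submatrix]
    have h' : colProj J * J.submatrix id finSumFinEquiv = J.submatrix id finSumFinEquiv :=
      congrArg (fun M : Matrix (Fin n) (Fin (r₁ + b)) ℝ => M.submatrix id finSumFinEquiv) h
    rwa [hsub] at h'
  rw [Matrix.mul_fromCols, Matrix.fromCols_ext_iff] at hJTK
  obtain ⟨hJT, hJK⟩ := hJTK
  have hJP : colProj J * colProj T = colProj T := mul_colProj_of_mul_eq hJT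
  have hJN : colProj J * N = N := by
    rw [← hTN, ← Matrix.mul_assoc, hJP]
  refine ⟨h12.trans h21.symm, r₁ + b, _, hmk.submatrix finSumFinEquiv.symm.injective, ?_⟩
  rw [hJ]
  exact ⟨hJgram, hJP, mul_colProj_of_mul_eq <| by
    simpa using hext (colProj J) 1 (by rw [hJN, Matrix.one_mul]) (by rw [hJK, Matrix.one_mul])⟩

end Commutation

section Diagonal

variable {n : ℕ}

lemma exp_diagonal_mem_Apos {b : Fin n → ℝ} (hb : ∑ k, b k = 0) :
    diagonal (fun k => Real.exp (b k)) ∈ Apos n :=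
  ⟨_, fun i => Real.exp_pos _, by rw [← Real.exp_sum, hb, Real.exp_zero], rfl⟩

lemma mul_mem_Apos {a a' : Matrix (Fin n) (Fin n) ℝ} (ha : a ∈ Apos n) (ha' : a' ∈ Apos n) :
    a * a' ∈ Apos n := by
  obtain ⟨d, hd, hp, rfl⟩ := ha
  obtain ⟨d', hd', hp', rfl⟩ := ha'
  refine ⟨fun i => d i * d' i, fun i => mul_pos (hd i) (hd' i), ?_, Matrix.diagonal_mul_diagonal _ _⟩
  rw [Finset.prod_mul_distrib, hp, hp', one_mul]

lemma one_mem_Apos : (1 : Matrix (Fin n) (Fin n) ℝ) ∈ Apos n :=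
  ⟨1, fun _ => one_pos, by simp, Matrix.diagonal_one.symm⟩

lemma det_of_mem_Apos {a : Matrix (Fin n) (Fin n) ℝ} (ha : a ∈ Apos n) : a.det = 1 := by
  obtain ⟨d, -, hp, rfl⟩ := ha
  rw [Matrix.det_diagonal, hp]

end Diagonal

section Improvement

variable {n : ℕ}

/-- Subgroups that are not extremal stay strictly non-extremal under small diagonal elements. -/
lemma exists_pos_nonextremal {y : Matrix (Fin n) (Fin n) ℝ} (hy : y.det ≠ 0) {c : ℝ} (h0 : 0 < c)
    (h1 : c ≤ 1) (hG : Good y c) (b : Fin n → ℝ) :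
    ∃ t : ℝ, 0 < t ∧ ∃ q : ℝ, 1 < q ∧ ∀ (r : ℕ) (m : Matrix (Fin n) (Fin r) ℤ), IntInj m →
      gram (y * realMat m) ≠ c ^ (2 * r) →
      q * c ^ (2 * r) ≤
        gram (diagonal (fun k => Real.exp ((t • b) k)) * (y * realMat m)) := by
  obtain ⟨η, hη, hgap⟩ := exists_gap hy h0 h1 hG
  obtain ⟨B, hB0, hB⟩ : ∃ B : ℝ, 0 ≤ B ∧ ∀ k, |b k| ≤ B :=
    ⟨∑ k, |b k|, Finset.sum_nonneg fun _ _ => abs_nonneg _, fun k =>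
      Finset.single_le_sum (fun i _ => abs_nonneg (b i)) (Finset.mem_univ k)⟩
  have hlim : Tendsto (fun t : ℝ => Real.exp (-(2 * n * (t * B))) * (1 + η)) (𝓝[>] 0)
      (𝓝 (1 + η)) := by
    have : Continuous fun t : ℝ => Real.exp (-(2 * n * (t * B))) * (1 + η) := by fun_prop
    simpa using (this.tendsto 0).mono_left nhdsWithin_le_nhds
  obtain ⟨t, ht1, ht0⟩ := ((hlim.eventually_const_lt (by linarith : (1 : ℝ) < 1 + η)).and
    self_mem_nhdsWithin).exists
  have ht0 : 0 < t := ht0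
  refine ⟨t, ht0, _, ht1, fun r m hm hne => ?_⟩
  have h2 := (hgap r m hm).resolve_left hne
  have h3 := exp_neg_mul_gram_le (y * realMat m) (t • b) (B := t * B) fun k => by
    rw [Pi.smul_apply, smul_eq_mul, abs_mul, abs_of_pos ht0]
    exact mul_le_mul_of_nonneg_left (hB k) ht0.le
  refine le_trans ?_ h3
  have hr : (r : ℝ) ≤ n := by simpa using hm.card_le
  rw [mul_assoc]
  refine mul_le_mul (Real.exp_le_exp.mpr ?_) h2 (by positivity) (Real.exp_pos _).le
  have : 0 ≤ t * B := by positivity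
  nlinarith

lemma rank_lt_of_gram_lt_one {y : Matrix (Fin n) (Fin n) ℝ} (hy : y.det = 1) {r : ℕ}
    {m : Matrix (Fin n) (Fin r) ℤ} (hm : IntInj m) (h : gram (y * realMat m) < 1) : r < n := by
  refine lt_of_le_of_ne (by simpa using hm.card_le) ?_
  rintro rfl
  rw [gram_square, Matrix.det_mul, hy, one_mul, ← gram_square] at h
  exact absurd (one_le_gram_realMat hm) (not_le.mpr h)

/-- A projection of trace at most that of a projection below it equals the latter. -/
lemma eq_of_mul_eq_of_trace_le {P Q : Matrix (Fin n) (Fin n) ℝ} (hP : Pᵀ = P) (hQ : Qᵀ = Q)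
    (hPP : P * P = P) (hQQ : Q * Q = Q) (h : P * Q = Q) (ht : P.trace ≤ Q.trace) : P = Q := by
  have h' : Q * P = Q := by
    have := congrArg Matrix.transpose h
    rwa [Matrix.transpose_mul, hP, hQ] at this
  have e : (P - Q)ᵀ * (P - Q) = P - Q := by
    rw [Matrix.transpose_sub, hP, hQ, Matrix.sub_mul, Matrix.mul_sub, Matrix.mul_sub, hPP, h, h',
      hQQ, sub_self, sub_zero]
  have hps := posSemidef_transpose_mul_self (P - Q)
  rw [e] at hps
  refine sub_eq_zero.mp (hps.trace_eq_zero_iff.mp (le_antisymm ?_ hps.trace_nonneg))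
  rw [Matrix.trace_sub]
  linarith

/-- A direction of zero first variation which does not preserve some extremal subgroup decreases the
set of extremal subgroups. -/
lemma exists_extremal_ncard_lt {y : Matrix (Fin n) (Fin n) ℝ} (hy : y.det ≠ 0) {c : ℝ} (h0 : 0 < c)
    (h1 : c ≤ 1) (hG : Good y c) {b : Fin n → ℝ} (hb : ∑ k, b k = 0)
    (htr : ∀ (r : ℕ) (m : Matrix (Fin n) (Fin r) ℤ), IntInj m →
      gram (y * realMat m) = c ^ (2 * r) → (diagonal b * colProj (y * realMat m)).trace = 0)
    {r : ℕ} {m : Matrix (Fin n) (Fin r) ℤ} (hm : IntInj m)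
    (he : gram (y * realMat m) = c ^ (2 * r))
    (hne : diagonal b * colProj (y * realMat m) ≠ colProj (y * realMat m) * diagonal b) :
    ∃ a ∈ Apos n, Good (a * y) c ∧ (extremal (a * y) c).ncard < (extremal y c).ncard := by
  obtain ⟨t, ht, q, hq, hgap⟩ := exists_pos_nonextremal hy h0 h1 hG b
  have htb : diagonal (t • b) = t • diagonal b := Matrix.diagonal_smul t b
  have htr' : ∀ (s : ℕ) (l : Matrix (Fin n) (Fin s) ℤ), IntInj l →
      gram (y * realMat l) = c ^ (2 * s) →
        (diagonal (t • b) * colProj (y * realMat l)).trace = 0 := by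
    intro s l hl h
    rw [htb, Matrix.smul_mul, Matrix.trace_smul, htr s l hl h, smul_zero]
  have hgt : ∀ (s : ℕ) (l : Matrix (Fin n) (Fin s) ℤ), IntInj l →
      gram (y * realMat l) ≠ c ^ (2 * s) →
        c ^ (2 * s) < gram (diagonal (fun k => Real.exp ((t • b) k)) * (y * realMat l)) :=
    fun s l hl h => lt_of_lt_of_le (lt_mul_of_one_lt_left (by positivity) hq) (hgap s l hl h)
  have ha : diagonal (fun k => Real.exp ((t • b) k)) ∈ Apos n :=
    exp_diagonal_mem_Apos (by simp [← Finset.mul_sum, hb])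
  refine ⟨_, ha, fun s l hl => ?_, Set.ncard_lt_ncard ⟨?_, fun hsub => ?_⟩
    (finite_extremal hy h0.le h1)⟩
  · rw [Matrix.mul_assoc]
    by_cases h : gram (y * realMat l) = c ^ (2 * s)
    · have := le_gram_exp_mul (y * realMat l) (gram_mul_realMat_pos hy hl).ne' (t • b)
      rwa [htr' s l hl h, mul_zero, add_zero, mul_one, h] at this
    · exact (hgt s l hl h).le
  · rintro _ ⟨s, l, hl, rfl, h⟩
    rw [mem_extremal_iff hl]
    by_contra hcon
    rw [Matrix.mul_assoc] at h
    exact (hgt s l hl hcon).ne' h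
  · have h := (mem_extremal_iff hm).mp (hsub ((mem_extremal_iff hm).mpr he))
    rw [Matrix.mul_assoc] at h
    have := commute_of_gram_exp_le _ (gram_mul_realMat_pos hy hm).ne' (t • b) (htr' r m hm he)
      (h.trans he.symm).le
    rw [htb, Matrix.smul_mul, Matrix.mul_smul] at this
    exact hne (smul_right_injective _ ht.ne' this)

/-- All extremal subgroups are contained in a single one. -/
lemma exists_max_extremal {y : Matrix (Fin n) (Fin n) ℝ} (hy : y.det ≠ 0) {c : ℝ} (h0 : 0 < c)
    (hG : Good y c) :
    ∃ (r : ℕ) (m : Matrix (Fin n) (Fin r) ℤ), IntInj m ∧ gram (y * realMat m) = c ^ (2 * r) ∧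
      ∀ (s : ℕ) (l : Matrix (Fin n) (Fin s) ℤ), IntInj l → gram (y * realMat l) = c ^ (2 * s) →
        colProj (y * realMat m) * colProj (y * realMat l) = colProj (y * realMat l) := by
  let p : ℕ → Prop := fun r => ∃ m : Matrix (Fin n) (Fin r) ℤ, IntInj m ∧
    gram (y * realMat m) = c ^ (2 * r)
  have hp : p 0 := ⟨0, fun z _ => Subsingleton.elim _ _, by simp [gram]⟩
  classical
  have hbd : ∀ r, p r → r ≤ n := fun r ⟨m, hm, _⟩ => by simpa using hm.card_le
  obtain ⟨m, hm, he⟩ := Nat.findGreatest_spec (P := p) (Nat.zero_le n) hp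
  refine ⟨_, m, hm, he, fun s l hl hle => ?_⟩
  obtain ⟨-, r, k, hk, hke, hkm, hkl⟩ := exists_join hy h0 hG hm hl he hle
  have hr : r ≤ Nat.findGreatest p n := Nat.le_findGreatest (hbd r ⟨k, hk, hke⟩) ⟨k, hk, hke⟩
  have hk0 := (gram_mul_realMat_pos hy hk).ne'
  have hm0 := (gram_mul_realMat_pos hy hm).ne'
  have := eq_of_mul_eq_of_trace_le (colProj_transpose _) (colProj_transpose _)
    (colProj_mul_colProj hk0) (colProj_mul_colProj hm0) hkm
    (by rw [trace_colProj hk0, trace_colProj hm0, Fintype.card_fin, Fintype.card_fin]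
        exact_mod_cast hr)
  rwa [← this]

/-- A diagonal direction of trace zero along which all extremal subgroups expand. -/
lemma exists_expanding_direction {y : Matrix (Fin n) (Fin n) ℝ} (hn : 0 < n) (hy : y.det = 1)
    {c : ℝ} (h0 : 0 < c) (h1 : c < 1) (hG : Good y c)
    (hL : ∀ b : Fin n → ℝ, ∑ k, b k = 0 →
      (∀ (r : ℕ) (m : Matrix (Fin n) (Fin r) ℤ), IntInj m → gram (y * realMat m) = c ^ (2 * r) →
        (diagonal b * colProj (y * realMat m)).trace = 0) →
      ∀ (r : ℕ) (m : Matrix (Fin n) (Fin r) ℤ), IntInj m → gram (y * realMat m) = c ^ (2 * r) →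
        diagonal b * colProj (y * realMat m) = colProj (y * realMat m) * diagonal b) :
    ∃ b : Fin n → ℝ, ∑ k, b k = 0 ∧ ∀ (r : ℕ) (m : Matrix (Fin n) (Fin r) ℤ), IntInj m →
      gram (y * realMat m) = c ^ (2 * r) → (diagonal b * colProj (y * realMat m)).trace = r := by
  have hy0 : y.det ≠ 0 := by simp [hy]
  obtain ⟨r₀, m₀, hm₀, he₀, hmax⟩ := exists_max_extremal hy0 h0 hG
  have hlt : r₀ < n := by
    rcases Nat.eq_zero_or_pos r₀ with h | h
    · omega
    · exact rank_lt_of_gram_lt_one hy hm₀ (he₀ ▸ pow_lt_one₀ h0.le h1 (by omega))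
  have hg₀ := (gram_mul_realMat_pos hy0 hm₀).ne'
  let ι := {x : Σ r : ℕ, Matrix (Fin n) (Fin r) ℤ //
    IntInj x.2 ∧ gram (y * realMat x.2) = c ^ (2 * x.1)}
  set P₀ := colProj (y * realMat m₀) with hP₀
  obtain ⟨b, hb, hbt⟩ := exists_diagonal_trace_eq
    (fun i : ι => colProj (y * realMat i.1.2)) (fun i => colProj_transpose _)
    (fun i j => (exists_join hy0 h0 hG i.2.1 j.2.1 i.2.2 j.2.2).1)
    (fun b hb h i => hL b hb (fun r m hm he => h ⟨⟨r, m⟩, hm, he⟩) _ _ i.2.1 i.2.2)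
    (P₀ - ((r₀ : ℝ) / ((n : ℝ) - r₀)) • (1 - P₀))
  refine ⟨b, ?_, fun r m hm he => ?_⟩
  · have : (n : ℝ) - r₀ ≠ 0 := sub_ne_zero.mpr (by exact_mod_cast hlt.ne')
    rw [hb, Matrix.trace_sub, Matrix.trace_smul, Matrix.trace_sub, hP₀, trace_colProj hg₀,
      Matrix.trace_one, Fintype.card_fin, Fintype.card_fin, smul_eq_mul, div_mul_cancel₀ _ this,
      sub_self]
  · rw [hbt ⟨⟨r, m⟩, hm, he⟩, Matrix.sub_mul, Matrix.smul_mul, Matrix.sub_mul, hmax r m hm he,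
      Matrix.one_mul, sub_self, smul_zero, sub_zero, trace_colProj (gram_mul_realMat_pos hy0 hm).ne',
      Fintype.card_fin]

lemma exists_good_gt_of_direction {y : Matrix (Fin n) (Fin n) ℝ} (hn : 0 < n) (hy : y.det ≠ 0)
    {c : ℝ} (h0 : 0 < c) (h1 : c ≤ 1) (hG : Good y c) {b : Fin n → ℝ} (hb : ∑ k, b k = 0)
    (hbt : ∀ (r : ℕ) (m : Matrix (Fin n) (Fin r) ℤ), IntInj m →
      gram (y * realMat m) = c ^ (2 * r) → (diagonal b * colProj (y * realMat m)).trace = r) :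
    ∃ a ∈ Apos n, ∃ c', c < c' ∧ Good (a * y) c' := by
  obtain ⟨t, ht, q, hq, hgap⟩ := exists_pos_nonextremal hy h0 h1 hG b
  have ha : diagonal (fun k => Real.exp ((t • b) k)) ∈ Apos n :=
    exp_diagonal_mem_Apos (by simp [← Finset.mul_sum, hb])
  have hQ : 1 < min q (1 + 2 * t) := lt_min hq (by linarith)
  set Q := min q (1 + 2 * t)
  have hn' : (0 : ℝ) < ((2 * n : ℕ) : ℝ)⁻¹ := by positivity
  have hκ : 1 < Q ^ (((2 * n : ℕ) : ℝ)⁻¹) := Real.one_lt_rpow hQ hn'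
  have hκn : (Q ^ (((2 * n : ℕ) : ℝ)⁻¹)) ^ (2 * n) = Q :=
    Real.rpow_inv_natCast_pow (by linarith) (by omega)
  set κ := Q ^ (((2 * n : ℕ) : ℝ)⁻¹)
  refine ⟨_, ha, κ * c, lt_mul_of_one_lt_left h0 hκ, fun r m hm => ?_⟩
  have hr : r ≤ n := by simpa using hm.card_le
  have hκr : κ ^ (2 * r) ≤ Q := hκn ▸ pow_le_pow_right₀ hκ.le (by omega)
  rw [Matrix.mul_assoc, mul_pow]
  by_cases he : gram (y * realMat m) = c ^ (2 * r)
  · have hle := le_gram_exp_mul (y * realMat m) (gram_mul_realMat_pos hy hm).ne' (t • b)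
    rw [Matrix.diagonal_smul, Matrix.smul_mul, Matrix.trace_smul, hbt r m hm he, he, mul_comm,
      smul_eq_mul] at hle
    refine le_trans (mul_le_mul_of_nonneg_right ?_ (by positivity)) hle
    rcases Nat.eq_zero_or_pos r with rfl | h
    · simp
    · have h' : (1 : ℝ) ≤ r := by exact_mod_cast h
      nlinarith [min_le_right q (1 + 2 * t)]
  · exact le_trans (mul_le_mul_of_nonneg_right (hκr.trans (min_le_left _ _)) (by positivity))
      (hgap r m hm he)

lemma exists_good_gt (hn : 0 < n) {h : Matrix (Fin n) (Fin n) ℝ} (hh : h.det = 1) {c : ℝ}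
    (h0 : 0 < c) (h1 : c < 1) (hG : Good h c) :
    ∃ a ∈ Apos n, ∃ c', c < c' ∧ Good (a * h) c' := by
  obtain ⟨a, ⟨ha, hGa⟩, hmin⟩ := (measure fun a => (extremal (a * h) c).ncard).wf.has_min
    {a | a ∈ Apos n ∧ Good (a * h) c} ⟨1, one_mem_Apos, by rwa [Matrix.one_mul]⟩
  have hy : (a * h).det = 1 := by rw [Matrix.det_mul, det_of_mem_Apos ha, hh, one_mul]
  have hy0 : (a * h).det ≠ 0 := by simp [hy]
  obtain ⟨b, hb, hbt⟩ := exists_expanding_direction hn hy h0 h1 hGa fun b hb htr r m hm he => by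
    by_contra hne
    obtain ⟨a', ha', hG', hlt⟩ := exists_extremal_ncard_lt hy0 h0 h1.le hGa hb htr hm he hne
    rw [← Matrix.mul_assoc] at hG' hlt
    exact hmin (a' * a) ⟨mul_mem_Apos ha' ha, hG'⟩ hlt
  obtain ⟨a', ha', c', hc, hG'⟩ := exists_good_gt_of_direction hn hy0 h0 h1.le hGa hb hbt
  exact ⟨a' * a, mul_mem_Apos ha' ha, c', hc, by rwa [Matrix.mul_assoc]⟩

end Improvement

section Orbit

variable {n : ℕ}

lemma exists_realMat_of_mem_Gam {γ : Matrix (Fin n) (Fin n) ℝ} (h : γ ∈ Gam n) :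
    ∃ m : Matrix (Fin n) (Fin n) ℤ, m.det = 1 ∧ γ = realMat m := by
  obtain ⟨hd, he⟩ := h
  choose m hm using he
  have e : γ = realMat (Matrix.of m) := by ext i j; simp [realMat, hm]
  refine ⟨Matrix.of m, ?_, e⟩
  have := (Int.castRingHom ℝ).map_det (Matrix.of m)
  rw [eq_intCast] at this
  have h2 : ((Int.castRingHom ℝ).mapMatrix (Matrix.of m)) = γ := e.symm
  rw [h2, hd] at this
  exact_mod_cast this

lemma realMat_one : realMat (1 : Matrix (Fin n) (Fin n) ℤ) = 1 := by simp [realMat]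

lemma intInj_of_det_eq_one {m : Matrix (Fin n) (Fin n) ℤ} (h : m.det = 1) : IntInj m :=
  fun _ hz => Matrix.eq_zero_of_mulVec_eq_zero (by simp [h]) hz

lemma IntInj.mul {ι : Type*} [Fintype ι] {m : Matrix (Fin n) (Fin n) ℤ}
    {l : Matrix (Fin n) ι ℤ} (hm : IntInj m) (hl : IntInj l) : IntInj (m * l) :=
  fun z hz => hl z (hm _ (by rwa [Matrix.mulVec_mulVec]))

lemma realMat_mul_realMat {ι : Type*} (m : Matrix (Fin n) (Fin n) ℤ) (l : Matrix (Fin n) ι ℤ) :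
    realMat (m * l) = realMat m * realMat l := realMat_mul m l

lemma Good.mul_right {y : Matrix (Fin n) (Fin n) ℝ} {c : ℝ} (h : Good y c)
    {m : Matrix (Fin n) (Fin n) ℤ} (hm : m.det = 1) : Good (y * realMat m) c := by
  intro r l hl
  rw [Matrix.mul_assoc, ← realMat_mul_realMat]
  exact h r (m * l) ((intInj_of_det_eq_one hm).mul hl)

lemma Good.of_mul_right {y : Matrix (Fin n) (Fin n) ℝ} {c : ℝ} {m : Matrix (Fin n) (Fin n) ℤ}
    (hm : m.det = 1) (h : Good (y * realMat m) c) : Good y c := by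
  have h' := h.mul_right (m := m.adjugate) (by rw [Matrix.det_adjugate, hm, one_pow])
  rw [Matrix.mul_assoc, ← realMat_mul_realMat, Matrix.mul_adjugate, hm, one_smul] at h'
  rwa [realMat_one, Matrix.mul_one] at h'

lemma continuous_gram_mul {r : ℕ} (N : Matrix (Fin n) (Fin r) ℝ) :
    Continuous fun y : Matrix (Fin n) (Fin n) ℝ => gram (y * N) := by
  unfold gram
  fun_prop

lemma Good.of_tendsto {y : ℕ → Matrix (Fin n) (Fin n) ℝ} {c : ℕ → ℝ}
    {h : Matrix (Fin n) (Fin n) ℝ} {s : ℝ} (hy : Tendsto y atTop (𝓝 h))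
    (hc : Tendsto c atTop (𝓝 s)) (hG : ∀ k, Good (y k) (c k)) : Good h s :=
  fun r m hm => le_of_tendsto_of_tendsto' (hc.pow (2 * r))
    (((continuous_gram_mul (realMat m)).tendsto h).comp hy) fun k => hG k r m hm

/-- Being good is stable under small perturbations, at the cost of a slightly worse constant. -/
lemma Good.eventually {h : Matrix (Fin n) (Fin n) ℝ} (hh : h.det ≠ 0) {c c' : ℝ}
    (hG : Good h c) (h0 : 0 < c') (hc : c' < c) : ∀ᶠ y in 𝓝 h, Good y c' := by
  have hc0 : 0 < c := h0.trans hc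
  set d := c' / c with hd
  have hd0 : 0 < d := div_pos h0 hc0
  have hd1 : d < 1 := (div_lt_one hc0).mpr hc
  set t := (1 - d ^ 2) / 2 with ht
  have ht0 : 0 < t := by have : d ^ 2 < 1 := pow_lt_one₀ hd0.le hd1 two_ne_zero; linarith
  have hu : IsUnit h.det := isUnit_iff_ne_zero.mpr hh
  have hcont : Continuous fun y : Matrix (Fin n) (Fin n) ℝ =>
      ∑ i, ∑ j, (y * h⁻¹ - 1) i j ^ 2 := by fun_prop
  have hz : ∑ i, ∑ j, (h * h⁻¹ - 1) i j ^ 2 < t ^ 2 := by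
    rw [Matrix.mul_nonsing_inv h hu]
    simp only [sub_self, Matrix.zero_apply]
    simpa using by positivity
  filter_upwards [(hcont.tendsto h).eventually_lt_const hz] with y hy
  have := hG.mul_left (M := y * h⁻¹) hd0.le fun v => by
    have := one_sub_mul_le ht0 hy.le v
    rwa [show 1 - 2 * t = d ^ 2 by rw [ht]; ring] at this
  rwa [Matrix.mul_assoc, Matrix.nonsing_inv_mul h hu, Matrix.mul_one, hd,
    div_mul_cancel₀ _ hc0.ne'] at this

lemma Good.le_one (hn : 0 < n) {y : Matrix (Fin n) (Fin n) ℝ} (hy : y.det = 1) {c : ℝ}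
    (h : Good y c) : c ≤ 1 := by
  have h1 := h n 1 (intInj_of_det_eq_one Matrix.det_one)
  rw [realMat_one, Matrix.mul_one, gram_square, hy, one_pow] at h1
  by_contra hc
  exact absurd h1 (not_le.mpr (one_lt_pow₀ (not_le.mp hc) (by omega)))

/-- A bounded orbit contains lattices which are arbitrarily close to being semistable. -/
theorem exists_good_of_hasBoundedAOrbit (hn : 0 < n) {g : Matrix (Fin n) (Fin n) ℝ}
    (hg : g.det = 1) (hb : HasBoundedAOrbit g) {c : ℝ} (hc0 : 0 ≤ c) (hc : c < 1) :
    ∃ a ∈ Apos n, Good (a * g) c := by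
  obtain ⟨K, hK, hKa⟩ := hb
  let S : Set ℝ := {c | 0 ≤ c ∧ ∃ a ∈ Apos n, Good (a * g) c}
  have hdet : ∀ {a}, a ∈ Apos n → (a * g).det = 1 := fun ha => by
    rw [Matrix.det_mul, det_of_mem_Apos ha, hg, one_mul]
  have hSb : BddAbove S := ⟨1, fun c ⟨_, a, ha, h⟩ => h.le_one hn (hdet ha)⟩
  obtain ⟨c₀, hc₀, hG₀⟩ := exists_good (y := g) (by simp [hg])
  have hc₀S : c₀ ∈ S := ⟨hc₀.le, 1, one_mem_Apos, by rwa [Matrix.one_mul]⟩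
  set s := sSup S
  have hs0 : 0 < s := hc₀.trans_le (le_csSup hSb hc₀S)
  suffices hs : 1 ≤ s by
    obtain ⟨c', ⟨_, a, ha, hG⟩, hlt⟩ := exists_lt_of_lt_csSup ⟨c₀, hc₀S⟩ (hc.trans_le hs)
    exact ⟨a, ha, hG.mono hc0 hlt.le⟩
  by_contra! hs
  obtain ⟨u, -, hu, huS⟩ := exists_seq_tendsto_sSup ⟨c₀, hc₀S⟩ hSb
  choose hu0 a ha hGa using huS
  choose γ hγ hγK using fun k => hKa (a k) (ha k)
  choose m hm hγm using fun k => exists_realMat_of_mem_Gam (hγ k)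
  have : FirstCountableTopology (Matrix (Fin n) (Fin n) ℝ) :=
    inferInstanceAs (FirstCountableTopology (Fin n → Fin n → ℝ))
  obtain ⟨h, -, φ, hφ, hlim⟩ := hK.tendsto_subseq hγK
  have hGh : Good h s := Good.of_tendsto hlim (hu.comp hφ.tendsto_atTop) fun k => by
    simpa only [Function.comp, hγm] using (hGa (φ k)).mul_right (hm (φ k))
  have hdet' : ∀ k, (a k * g * γ k).det = 1 := fun k => by
    rw [Matrix.det_mul, hdet (ha k), (hγ k).1, one_mul]
  have hh : h.det = 1 := tendsto_nhds_unique
    ((Continuous.matrix_det continuous_id).tendsto h |>.comp hlim)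
    (by simp [Function.comp_def, hdet'])
  obtain ⟨b, hb, c₁, hc₁, hG₁⟩ := exists_good_gt hn hh hs0 hs hGh
  obtain ⟨c₂, hc₂, hc₂'⟩ := exists_between hc₁
  have hbh : (b * h).det ≠ 0 := by rw [Matrix.det_mul, det_of_mem_Apos hb, hh]; simp
  have hcont : Continuous fun y : Matrix (Fin n) (Fin n) ℝ => b * y := by fun_prop
  obtain ⟨k, hk⟩ := (((hcont.tendsto h).comp hlim).eventually
    (hG₁.eventually hbh (hs0.trans hc₂) hc₂')).exists
  have hk' : Good (b * a (φ k) * g) c₂ := by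
    refine Good.of_mul_right (hm (φ k)) ?_
    simpa only [Function.comp, hγm, Matrix.mul_assoc] using hk
  exact absurd (le_csSup hSb ⟨(hs0.trans hc₂).le, _, mul_mem_Apos hb (ha _), hk'⟩)
    (not_le.mpr hc₂)

end Orbit

section Translation

variable {n : ℕ}

/-- The parametrisation of the lattice `yℤⁿ` by `ℤⁿ`. -/
def latHom (y : Matrix (Fin n) (Fin n) ℝ) : (Fin n → ℤ) →+ (Fin n → ℝ) where
  toFun z := y *ᵥ fun i => (z i : ℝ)
  map_zero' := by ext; simp [Matrix.mulVec, dotProduct]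
  map_add' z w := by rw [← Matrix.mulVec_add]; congr 1; ext i; simp

lemma latticeOf_eq_range (y : Matrix (Fin n) (Fin n) ℝ) : latticeOf y = (latHom y).range := by
  rw [← AddSubgroup.closure_eq (latHom y).range]
  rfl

lemma mapLat_latticeOf (a g : Matrix (Fin n) (Fin n) ℝ) :
    mapLat a (latticeOf g) = latticeOf (a * g) := by
  rw [latticeOf_eq_range, latticeOf_eq_range, mapLat, AddMonoidHom.map_range]
  congr 1
  refine AddMonoidHom.ext fun z => ?_
  exact Matrix.mulVec_mulVec (fun i => (z i : ℝ)) a g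

lemma gvol_eq_sqrt_gram {r : ℕ} (N : Matrix (Fin n) (Fin r) ℝ) : gvol N.col = √(gram N) := rfl

lemma linearIndependent_col_of_gram_ne_zero {r : ℕ} {N : Matrix (Fin n) (Fin r) ℝ}
    (h : gram N ≠ 0) : LinearIndependent ℝ N.col := by
  rw [← Matrix.mulVec_injective_iff]
  refine (injective_iff_map_eq_zero N.mulVecLin).mpr fun z hz => ?_
  refine Matrix.eq_zero_of_mulVec_eq_zero h ?_
  rw [← Matrix.mulVec_mulVec]
  rw [Matrix.mulVecLin_apply] at hz
  rw [hz, Matrix.mulVec_zero]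

lemma col_mul_realMat {r : ℕ} (y : Matrix (Fin n) (Fin n) ℝ) (m : Matrix (Fin n) (Fin r) ℤ) :
    (y * realMat m).col = latHom y ∘ m.col := rfl

lemma rk_closure_range {r : ℕ} {v : Fin r → Fin n → ℝ} (hv : LinearIndependent ℝ v) :
    rk (AddSubgroup.closure (Set.range v)) = r := by
  have : Submodule.span ℝ (AddSubgroup.closure (Set.range v) : Set (Fin n → ℝ)) =
      Submodule.span ℝ (Set.range v) := by
    refine le_antisymm (Submodule.span_le.mpr ?_)
      (Submodule.span_mono AddSubgroup.subset_closure)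
    exact (AddSubgroup.closure_le (Submodule.span ℝ (Set.range v)).toAddSubgroup).mpr
      Submodule.subset_span
  rw [rk, this, finrank_span_eq_card hv, Fintype.card_fin]

lemma covolSpec_map_closure {y : Matrix (Fin n) (Fin n) ℝ} (hy : y.det ≠ 0) {r : ℕ}
    {m : Matrix (Fin n) (Fin r) ℤ} (hm : IntInj m) :
    covolSpec ((AddSubgroup.closure (Set.range m.col)).map (latHom y)) √(gram (y * realMat m)) := by
  refine ⟨r, (y * realMat m).col,
    linearIndependent_col_of_gram_ne_zero (gram_mul_realMat_pos hy hm).ne', ?_, rfl⟩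
  rw [AddMonoidHom.map_closure, col_mul_realMat, Set.range_comp]

lemma exists_intInj_closure_eq (M : AddSubgroup (Fin n → ℤ)) :
    ∃ (r : ℕ) (m : Matrix (Fin n) (Fin r) ℤ), IntInj m ∧
      AddSubgroup.closure (Set.range m.col) = M := by
  let N : Submodule ℤ (Fin n → ℤ) :=
    { M with smul_mem' := fun z _ hv => M.zsmul_mem hv z }
  obtain ⟨r, ⟨b⟩⟩ := Submodule.nonempty_basis_of_pid (Pi.basisFun ℤ (Fin n)) N
  refine ⟨r, (Matrix.of fun j => (b j : Fin n → ℤ))ᵀ, intInj_iff.mpr ?_, ?_⟩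
  · exact b.linearIndependent.map' N.subtype (Submodule.ker_subtype _)
  · refine le_antisymm ((AddSubgroup.closure_le M).mpr ?_) fun v hv => ?_
    · rintro _ ⟨j, rfl⟩
      exact (b j).2
    · have e : v = ∑ j, b.repr ⟨v, hv⟩ j • (b j : Fin n → ℤ) := by
        have := congrArg N.subtype (b.sum_repr ⟨v, hv⟩)
        rw [map_sum] at this
        exact this.symm
      rw [e]
      exact sum_mem fun j _ => zsmul_mem (AddSubgroup.subset_closure (Set.mem_range_self j)) _

lemma exists_covolSpec {y : Matrix (Fin n) (Fin n) ℝ} (hy : y.det ≠ 0)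
    {Λ : AddSubgroup (Fin n → ℝ)} (hΛ : Λ ≤ latticeOf y) : ∃ q, covolSpec Λ q := by
  obtain ⟨r, m, hm, e⟩ := exists_intInj_closure_eq (Λ.comap (latHom y))
  have := covolSpec_map_closure hy hm
  rw [e, AddSubgroup.map_comap_eq, ← latticeOf_eq_range, inf_eq_right.mpr hΛ] at this
  exact ⟨_, this⟩

lemma Good.pow_rk_le {y : Matrix (Fin n) (Fin n) ℝ} {c : ℝ} (hG : Good y c)
    {Λ : AddSubgroup (Fin n → ℝ)} (hΛ : Λ ≤ latticeOf y) {q : ℝ} (hq : covolSpec Λ q) :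
    c ^ rk Λ ≤ q := by
  obtain ⟨r, v, hv, rfl, rfl⟩ := hq
  have hmem : ∀ j, ∃ z, latHom y z = v j := fun j => by
    have := hΛ (AddSubgroup.subset_closure (Set.mem_range_self j))
    rwa [latticeOf_eq_range] at this
  choose z hz using hmem
  have e : v = (y * realMat (Matrix.of z)ᵀ).col := (funext hz).symm
  have hm : IntInj (Matrix.of z)ᵀ := by
    intro w hw
    rw [e, ← Matrix.mulVec_injective_iff] at hv
    have h0 := @hv (fun j => (w j : ℝ)) 0 (by
      simp only [← Matrix.mulVec_mulVec, realMat_mulVec, hw]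
      simp [← Pi.zero_def])
    funext j
    simpa using congrFun h0 j
  rw [rk_closure_range hv, e, gvol_eq_sqrt_gram]
  refine Real.le_sqrt_of_sq_le ?_
  rw [← pow_mul, mul_comm]
  exact hG r _ hm

lemma rk_ne_zero {Λ : AddSubgroup (Fin n → ℝ)} (h : Λ ≠ ⊥) : rk Λ ≠ 0 := by
  intro h0
  refine h (eq_bot_iff.mpr fun v hv => ?_)
  have hs := Submodule.finrank_eq_zero.mp h0
  have : v ∈ Submodule.span ℝ (Λ : Set (Fin n → ℝ)) := Submodule.subset_span hv
  rw [hs] at this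
  exact this

lemma Good.le_alpha {y : Matrix (Fin n) (Fin n) ℝ} (hy : y.det ≠ 0) {c : ℝ} (hc : 0 ≤ c)
    (hG : Good y c) (hne : latticeOf y ≠ ⊥) : c ≤ alpha (latticeOf y) := by
  refine le_csInf ⟨_, latticeOf y, le_rfl, hne, rfl⟩ ?_
  rintro _ ⟨Λ, hΛ, h0, rfl⟩
  have h1 : c ^ rk Λ ≤ covol Λ :=
    le_csInf (exists_covolSpec hy hΛ) fun q hq => hG.pow_rk_le hΛ hq
  calc c = (c ^ rk Λ) ^ ((rk Λ : ℝ)⁻¹) := (Real.pow_rpow_inv_natCast hc (rk_ne_zero h0)).symm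
    _ ≤ _ := Real.rpow_le_rpow (pow_nonneg hc _) h1 (by positivity)

lemma covolSpec_nonneg {Λ : AddSubgroup (Fin n → ℝ)} {q : ℝ} (h : covolSpec Λ q) : 0 ≤ q := by
  obtain ⟨r, v, -, -, rfl⟩ := h
  exact Real.sqrt_nonneg _

lemma closure_range_col_one :
    AddSubgroup.closure (Set.range (1 : Matrix (Fin n) (Fin n) ℤ).col) = ⊤ := by
  refine (AddSubgroup.eq_top_iff' _).mpr fun z => ?_
  have : z = ∑ j, z j • (1 : Matrix (Fin n) (Fin n) ℤ).col j := by
    ext i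
    simp [Matrix.one_apply]
  rw [this]
  exact sum_mem fun j _ => zsmul_mem (AddSubgroup.subset_closure (Set.mem_range_self j)) _

lemma covolSpec_latticeOf {y : Matrix (Fin n) (Fin n) ℝ} (hy : y.det = 1) :
    covolSpec (latticeOf y) 1 := by
  have h := covolSpec_map_closure (y := y) (by simp [hy]) (intInj_of_det_eq_one Matrix.det_one)
  rw [closure_range_col_one, ← AddMonoidHom.range_eq_map, ← latticeOf_eq_range, realMat_one,
    Matrix.mul_one, gram_square, hy, one_pow, Real.sqrt_one] at h
  exact h

lemma rk_latticeOf {y : Matrix (Fin n) (Fin n) ℝ} (hy : y.det ≠ 0) : rk (latticeOf y) = n := by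
  have e : latticeOf y = AddSubgroup.closure (Set.range y.col) := by
    rw [latticeOf_eq_range, AddMonoidHom.range_eq_map, ← closure_range_col_one,
      AddMonoidHom.map_closure, ← Set.range_comp, ← col_mul_realMat, realMat_one, Matrix.mul_one]
  rw [e, rk_closure_range]
  exact linearIndependent_col_of_gram_ne_zero (by rw [gram_square]; exact pow_ne_zero 2 hy)

lemma dimdelta_eq_of_good (hn : 0 < n) {y : Matrix (Fin n) (Fin n) ℝ} (hy : y.det = 1) {c δ : ℝ}
    (hc : 0 ≤ c) (hδ : 1 < (1 + δ) * c) (hG : Good y c) : dimdelta δ (latticeOf y) = n := by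
  have hy0 : y.det ≠ 0 := by simp [hy]
  have hrk := rk_latticeOf hy0
  have hne : latticeOf y ≠ ⊥ := by
    intro h
    rw [h] at hrk
    rw [rk, AddSubgroup.coe_bot, Submodule.span_zero_singleton, finrank_bot] at hrk
    omega
  have hδ0 : 0 ≤ 1 + δ := by
    by_contra! h
    nlinarith
  have h1 : covol (latticeOf y) ≤ 1 :=
    csInf_le ⟨0, fun q hq => covolSpec_nonneg hq⟩ (covolSpec_latticeOf hy)
  have h0 : 0 ≤ covol (latticeOf y) := Real.sInf_nonneg fun q hq => covolSpec_nonneg hq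
  have hmem : latticeOf y ∈ MinSet δ (latticeOf y) := by
    refine ⟨le_rfl, hne, (Real.rpow_le_one h0 h1 (by positivity)).trans_lt (hδ.trans_le ?_)⟩
    exact mul_le_mul_of_nonneg_left (hG.le_alpha hy0 hc hne) hδ0
  refine le_antisymm ((Submodule.finrank_le _).trans_eq (by simp)) ?_
  calc n = rk (latticeOf y) := hrk.symm
    _ ≤ _ := Submodule.finrank_mono (Submodule.span_mono (Set.subset_biUnion_of_mem
      (u := fun Λ : AddSubgroup (Fin n → ℝ) => (Λ : Set (Fin n → ℝ))) hmem))

end Translation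

end SW

/-- **Theorem 2.7.** If `A·x` is bounded then for any `ε ∈ (0,1)` the set `U_n^{x,ε}` is
nonempty. -/
theorem SW.Un_nonempty (n : ℕ) (hn : 0 < n)
    (g : Matrix (Fin n) (Fin n) ℝ) (hg : g.det = 1) (hb : SW.HasBoundedAOrbit g)
    (ε : ℝ) (hε : ε ∈ Set.Ioo (0 : ℝ) 1) :
    (SW.Uset (SW.latticeOf g) ε n).Nonempty := by
  have hnε : 0 < n * ε := mul_pos (Nat.cast_pos.mpr hn) hε.1
  have hpos : 0 < 1 + n * ε / 2 := by positivity
  obtain ⟨a, ha, hG⟩ := SW.exists_good_of_hasBoundedAOrbit hn hg hb (c := (1 + n * ε / 2)⁻¹)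
    (by positivity) (inv_lt_one_of_one_lt₀ (by linarith))
  refine ⟨a, ha, Set.Ioi (n * ε / 2), Ioi_mem_nhds (by linarith), fun δ hδ => ?_⟩
  rw [SW.mapLat_latticeOf]
  refine SW.dimdelta_eq_of_good hn ?_ (by positivity) ?_ hG
  · rw [Matrix.det_mul, SW.det_of_mem_Apos ha, hg, one_mul]
  · rw [← div_eq_mul_inv, one_lt_div hpos]
    linarith [Set.mem_Ioi.mp hδ]
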